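/- arXiv:1810.11950 — 11 statements merged into one kernel-verified Lean document; each statement's English description precedes it below -/
import Mathlib

section
/- Consider two discrete-time trajectories in feedback: sequences x₁ : ℕ → ℝ^{n₁}, x₂ : ℕ → ℝ^{n₂}, u₁, y₁, u₂, y₂, r₁, r₂ : ℕ → ℝ^m with interconnection u₁[k] = r₁[k] − y₂[k] and u₂[k] = r₂[k] + y₁[k] for all k. Suppose there are functions V₁ : ℝ^{n₁} → ℝ, V₂ : ℝ^{n₂} → ℝ and constants νᵢ, ρᵢ ∈ ℝ, δᵢ ≥ 0 (i = 1, 2) such that Vᵢ(xᵢ[k+1]) − Vᵢ(xᵢ[k]) ≤ ⟨uᵢ[k], yᵢ[k]⟩ − νᵢ‖uᵢ[k]‖² − ρᵢ‖yᵢ[k]‖² + δᵢ for all k. Let ν̂ < min{ν₁, ν₂} and ρ̂ ≤ min{ρ₁ − ν̂ν₂/(ν₂ − ν̂), ρ₂ − ν̂ν₁/(ν₁ − ν̂)}. Then the feedback-connected system is IF-OFQP(ν̂, ρ̂, δ₁ + δ₂) with respect to input r[k] = (r₁[k], r₂[k]) ∈ ℝ^{2m} and output y[k] = (y₁[k], y₂[k])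 ∈ ℝ^{2m}: with V(x₁, x₂) := V₁(x₁) + V₂(x₂), one has V(x₁[k+1], x₂[k+1]) − V(x₁[k], x₂[k]) ≤ ⟨r[k], y[k]⟩ − ν̂‖r[k]‖² − ρ̂‖y[k]‖² + (δ₁ + δ₂) for all k. -/
open scoped RealInnerProductSpace

/-- A weighted Young inequality: for `μ < ν`, the quantity `μ‖r‖²` is controlled by `ν‖r - y‖²`
up to a multiple of `‖y‖²`. The difference of the two sides is `‖(ν - μ) r - ν y‖² / (ν - μ)`. -/
theorem mul_norm_sq_le_mul_norm_sub_sq_add {E : Type*} [NormedAddCommGroup E]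
    [InnerProductSpace ℝ E] {μ ν : ℝ} (h : μ < ν) (r y : E) :
    μ * ‖r‖ ^ 2 ≤ ν * ‖r - y‖ ^ 2 + μ * ν / (ν - μ) * ‖y‖ ^ 2 := by
  have hpos : 0 < ν - μ := sub_pos.mpr h
  have key : ν * ‖r - y‖ ^ 2 + μ * ν / (ν - μ) * ‖y‖ ^ 2 - μ * ‖r‖ ^ 2
      = ‖(ν - μ) • r - ν • y‖ ^ 2 / (ν - μ) := by
    rw [norm_sub_sq_real, norm_sub_sq_real, norm_smul, norm_smul, real_inner_smul_left,
      real_inner_smul_right, mul_pow, mul_pow, Real.norm_eq_abs, Real.norm_eq_abs, sq_abs, sq_abs]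
    field_simp
    ring
  have hnonneg : 0 ≤ ‖(ν - μ) • r - ν • y‖ ^ 2 / (ν - μ) := by positivity
  linarith

/-- the feedback connection of two IF-OFQP discrete-time trajectories is
IF-OFQP(ν̂, ρ̂, δ₁ + δ₂) with respect to the stacked reference input `r = (r₁, r₂)` and
stacked output `y = (y₁, y₂)` (Euclidean norms/inner products of the stacked vectors are
written out componentwise). -/
theorem stmt_1 {n₁ n₂ m : ℕ}
    (x₁ : ℕ → EuclideanSpace ℝ (Fin n₁)) (x₂ : ℕ → EuclideanSpace ℝ (Fin n₂))
    (u₁ y₁ u₂ y₂ r₁ r₂ : ℕ → EuclideanSpace ℝ (Fin m))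
    (hint₁ : ∀ k, u₁ k = r₁ k - y₂ k) (hint₂ : ∀ k, u₂ k = r₂ k + y₁ k)
    (V₁ : EuclideanSpace ℝ (Fin n₁) → ℝ) (V₂ : EuclideanSpace ℝ (Fin n₂) → ℝ)
    (ν₁ ν₂ ρ₁ ρ₂ δ₁ δ₂ : ℝ) (hδ₁ : 0 ≤ δ₁) (hδ₂ : 0 ≤ δ₂)
    (hdiss₁ : ∀ k, V₁ (x₁ (k + 1)) - V₁ (x₁ k) ≤
      ⟪u₁ k, y₁ k⟫ - ν₁ * ‖u₁ k‖ ^ 2 - ρ₁ * ‖y₁ k‖ ^ 2 + δ₁)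
    (hdiss₂ : ∀ k, V₂ (x₂ (k + 1)) - V₂ (x₂ k) ≤
      ⟪u₂ k, y₂ k⟫ - ν₂ * ‖u₂ k‖ ^ 2 - ρ₂ * ‖y₂ k‖ ^ 2 + δ₂)
    (νh ρh : ℝ) (hνh : νh < min ν₁ ν₂)
    (hρh : ρh ≤ min (ρ₁ - νh * ν₂ / (ν₂ - νh)) (ρ₂ - νh * ν₁ / (ν₁ - νh))) :
    ∀ k, (V₁ (x₁ (k + 1)) + V₂ (x₂ (k + 1))) - (V₁ (x₁ k) + V₂ (x₂ k)) ≤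
      (⟪r₁ k, y₁ k⟫ + ⟪r₂ k, y₂ k⟫)
        - νh * (‖r₁ k‖ ^ 2 + ‖r₂ k‖ ^ 2) - ρh * (‖y₁ k‖ ^ 2 + ‖y₂ k‖ ^ 2)
        + (δ₁ + δ₂) := by
  intro k
  obtain ⟨hν₁, hν₂⟩ := lt_min_iff.mp hνh
  obtain ⟨hρ₁, hρ₂⟩ := le_min_iff.mp hρh
  have hr₁ := mul_norm_sq_le_mul_norm_sub_sq_add hν₁ (r₁ k) (y₂ k)
  have hr₂ := mul_norm_sq_le_mul_norm_sub_sq_add hν₂ (r₂ k) (-y₁ k)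
  rw [sub_neg_eq_add, norm_neg] at hr₂
  have hy₁ := mul_le_mul_of_nonneg_right hρ₁ (sq_nonneg ‖y₁ k‖)
  have hy₂ := mul_le_mul_of_nonneg_right hρ₂ (sq_nonneg ‖y₂ k‖)
  have h₁ := hdiss₁ k
  have h₂ := hdiss₂ k
  rw [hint₁ k, inner_sub_left] at h₁
  rw [hint₂ k, inner_add_left] at h₂
  have hcomm : ⟪y₁ k, y₂ k⟫ = ⟪y₂ k, y₁ k⟫ := real_inner_comm _ _
  linarith
end

section
/- Consider two discrete-time trajectories in feedback: x₁ : ℕ → ℝ^{n₁}, x₂ : ℕ → ℝ^{n₂}, u₁, y₁, u₂, y₂, r₁, r₂ : ℕ → ℝ^m with u₁[k] = r₁[k] − y₂[k] and u₂[k] = r₂[k] + y₁[k] for all k. Suppose the first subsystem is N₁-step strongly detectable with constant ϑ₁ ≥ 0 and function p₁ : ℝ^{n₁} → ℝ≥0, i.e., ∑_{k=k₀}^{k₀+N₁} (ϑ₁‖u₁[k]‖² + ‖y₁[k]‖²) ≥ p₁(x₁[k₀]) for all k₀ ∈ ℕ, and the second subsystem is N₂-step strongly detectable with ϑ₂ ≥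 0 and p₂ : ℝ^{n₂} → ℝ≥0, i.e., ∑_{k=k₀}^{k₀+N₂} (ϑ₂‖u₂[k]‖² + ‖y₂[k]‖²) ≥ p₂(x₂[k₀]) for all k₀. Let N = max{N₁, N₂} and ϑ = max{2ϑ₁/(2ϑ₁+1), 2ϑ₂/(2ϑ₂+1)}. Then the feedback-connected system is N-step strongly detectable with respect to the input r[k] = (r₁[k], r₂[k]) and output y[k] = (y₁[k], y₂[k]): for all k₀ ∈ ℕ, ∑_{k=k₀}^{k₀+N} (ϑ‖r[k]‖² + ‖y[k]‖²) ≥ (1 − ϑ)(p₁(x₁[k₀]) + p₂(x₂[k₀])). -/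
/-- If `t` dominates `2ϑ / (2ϑ + 1)`, then `2ϑ (1 - t) ≤ t`. -/
lemma two_mul_mul_one_sub_le {ϑ t : ℝ} (hϑ : 0 ≤ ϑ) (ht : 2 * ϑ / (2 * ϑ + 1) ≤ t) :
    2 * ϑ * (1 - t) ≤ t := by
  rw [div_le_iff₀ (by linarith)] at ht
  linarith

lemma two_mul_div_two_mul_add_one_le_one {ϑ : ℝ} (hϑ : 0 ≤ ϑ) :
    2 * ϑ / (2 * ϑ + 1) ≤ 1 := by
  rw [div_le_one (by linarith)]
  linarith

lemma sq_norm_add_le_two_mul {E : Type*} [SeminormedAddCommGroup E] (a b : E) :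
    ‖a + b‖ ^ 2 ≤ 2 * (‖a‖ ^ 2 + ‖b‖ ^ 2) :=
  (pow_le_pow_left₀ (norm_nonneg _) (norm_add_le a b) 2).trans add_sq_le

lemma mul_mul_sq_norm_add_le {E : Type*} [SeminormedAddCommGroup E] {ϑ t : ℝ}
    (hϑ : 0 ≤ ϑ) (ht : 2 * ϑ / (2 * ϑ + 1) ≤ t) (ht₁ : t ≤ 1) (a b : E) :
    (1 - t) * (ϑ * ‖a + b‖ ^ 2) ≤ t * (‖a‖ ^ 2 + ‖b‖ ^ 2) :=
  calc (1 - t) * (ϑ * ‖a + b‖ ^ 2)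
      ≤ (1 - t) * (ϑ * (2 * (‖a‖ ^ 2 + ‖b‖ ^ 2))) :=
        mul_le_mul_of_nonneg_left
          (mul_le_mul_of_nonneg_left (sq_norm_add_le_two_mul a b) hϑ) (sub_nonneg.2 ht₁)
    _ = 2 * ϑ * (1 - t) * (‖a‖ ^ 2 + ‖b‖ ^ 2) := by ring
    _ ≤ t * (‖a‖ ^ 2 + ‖b‖ ^ 2) :=
        mul_le_mul_of_nonneg_right (two_mul_mul_one_sub_le hϑ ht) (by positivity)

lemma sum_Icc_add_le_sum_Icc_add {f : ℕ → ℝ} (hf : ∀ k, 0 ≤ f k) (k₀ : ℕ) {M N : ℕ}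
    (h : M ≤ N) : ∑ k ∈ Finset.Icc k₀ (k₀ + M), f k ≤ ∑ k ∈ Finset.Icc k₀ (k₀ + N), f k :=
  Finset.sum_le_sum_of_subset_of_nonneg (Finset.Icc_subset_Icc le_rfl (by omega))
    fun k _ _ => hf k

/-- strong detectability of the feedback connection of two N-step strongly
detectable discrete-time trajectories, with respect to the stacked reference input
`r = (r₁, r₂)` and stacked output `y = (y₁, y₂)` (Euclidean norms of the stacked vectors
are written out componentwise). -/
theorem stmt_2 {n₁ n₂ m : ℕ}
    (x₁ : ℕ → EuclideanSpace ℝ (Fin n₁)) (x₂ : ℕ → EuclideanSpace ℝ (Fin n₂))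
    (u₁ y₁ u₂ y₂ r₁ r₂ : ℕ → EuclideanSpace ℝ (Fin m))
    (hint₁ : ∀ k, u₁ k = r₁ k - y₂ k) (hint₂ : ∀ k, u₂ k = r₂ k + y₁ k)
    (N₁ N₂ : ℕ) (ϑ₁ ϑ₂ : ℝ) (hϑ₁ : 0 ≤ ϑ₁) (hϑ₂ : 0 ≤ ϑ₂)
    (p₁ : EuclideanSpace ℝ (Fin n₁) → ℝ) (p₂ : EuclideanSpace ℝ (Fin n₂) → ℝ)
    (hp₁ : ∀ z, 0 ≤ p₁ z) (hp₂ : ∀ z, 0 ≤ p₂ z)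
    (hdet₁ : ∀ k₀ : ℕ,
      p₁ (x₁ k₀) ≤ ∑ k ∈ Finset.Icc k₀ (k₀ + N₁), (ϑ₁ * ‖u₁ k‖ ^ 2 + ‖y₁ k‖ ^ 2))
    (hdet₂ : ∀ k₀ : ℕ,
      p₂ (x₂ k₀) ≤ ∑ k ∈ Finset.Icc k₀ (k₀ + N₂), (ϑ₂ * ‖u₂ k‖ ^ 2 + ‖y₂ k‖ ^ 2)) :
    ∀ k₀ : ℕ,
      (1 - max (2 * ϑ₁ / (2 * ϑ₁ + 1)) (2 * ϑ₂ / (2 * ϑ₂ + 1))) *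
          (p₁ (x₁ k₀) + p₂ (x₂ k₀)) ≤
        ∑ k ∈ Finset.Icc k₀ (k₀ + max N₁ N₂),
          (max (2 * ϑ₁ / (2 * ϑ₁ + 1)) (2 * ϑ₂ / (2 * ϑ₂ + 1)) *
              (‖r₁ k‖ ^ 2 + ‖r₂ k‖ ^ 2) + (‖y₁ k‖ ^ 2 + ‖y₂ k‖ ^ 2)) := by
  intro k₀
  have ht₁ := le_max_left (2 * ϑ₁ / (2 * ϑ₁ + 1)) (2 * ϑ₂ / (2 * ϑ₂ + 1))
  have ht₂ := le_max_right (2 * ϑ₁ / (2 * ϑ₁ + 1)) (2 * ϑ₂ / (2 * ϑ₂ + 1))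
  have ht : max (2 * ϑ₁ / (2 * ϑ₁ + 1)) (2 * ϑ₂ / (2 * ϑ₂ + 1)) ≤ 1 :=
    max_le (two_mul_div_two_mul_add_one_le_one hϑ₁) (two_mul_div_two_mul_add_one_le_one hϑ₂)
  generalize max (2 * ϑ₁ / (2 * ϑ₁ + 1)) (2 * ϑ₂ / (2 * ϑ₂ + 1)) = t at *
  have h₁ := (hdet₁ k₀).trans
    (sum_Icc_add_le_sum_Icc_add (fun k => by positivity) k₀ (le_max_left N₁ N₂))
  have h₂ := (hdet₂ k₀).trans
    (sum_Icc_add_le_sum_Icc_add (fun k => by positivity) k₀ (le_max_right N₁ N₂))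
  refine (mul_le_mul_of_nonneg_left (add_le_add h₁ h₂) (sub_nonneg.2 ht)).trans ?_
  rw [← Finset.sum_add_distrib, Finset.mul_sum]
  refine Finset.sum_le_sum fun k _ => ?_
  have e₁ := mul_mul_sq_norm_add_le hϑ₁ ht₁ ht (r₁ k) (-y₂ k)
  have e₂ := mul_mul_sq_norm_add_le hϑ₂ ht₂ ht (r₂ k) (y₁ k)
  rw [norm_neg, ← sub_eq_add_neg, ← hint₁] at e₁
  rw [← hint₂] at e₂
  linarith
end

section
/- Let x : ℕ → ℝⁿ, u, y : ℕ → ℝ^m be a discrete-time trajectory, and suppose: (1) it is N-step strongly detectable with constants ϑ ≥ 0 and a function p : ℝⁿ → ℝ≥0, i.e., ∑_{k=k₀}^{k₀+N} (ϑ‖u[k]‖² + ‖y[k]‖²) ≥ p(x[k₀]) for all k₀; (2) there is a function V : ℝⁿ → ℝ≥0 and constants ν ∈ ℝ, ρ > 0, δ ≥ 0 with V(x[k+1]) − V(x[k]) ≤ ⟨u[k], y[k]⟩ − ν‖u[k]‖² − ρ‖y[k]‖² + δ for all k; (3) the input is bounded: ‖u[k]‖ ≤ U for all k. Let 0 < λ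 < ρ with η₁ := 1/(4λ) − ν > 0 and set η₂ := ρ − λ > 0. Define c₂ = (N+1)[(η₁ + ϑη₂)U² + δ], c₃ = (N+1)(η₁U² + δ), ξ₂ = max{p(x[0]), c₂/η₂}, and let c₁ be any real number with V(z) ≤ c₁ for all z ∈ ℝⁿ satisfying p(z) ≤ ξ₂. Then V(x[k]) ≤ c₁ + c₃ for all k ∈ ℕ. -/
open scoped RealInnerProductSpace

/-- Young's inequality for the inner product, with weight `lam`. -/
theorem inner_le_norm_sq_div_add_mul_norm_sq {E : Type*} [NormedAddCommGroup E]
    [InnerProductSpace ℝ E] (a b : E) {lam : ℝ} (hlam : 0 < lam) :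
    ⟪a, b⟫ ≤ 1 / (4 * lam) * ‖a‖ ^ 2 + lam * ‖b‖ ^ 2 := by
  refine (real_inner_le_norm a b).trans ?_
  have h : 1 / (4 * lam) * ‖a‖ ^ 2 + lam * ‖b‖ ^ 2 - ‖a‖ * ‖b‖ =
      (‖a‖ - 2 * lam * ‖b‖) ^ 2 / (4 * lam) := by
    field_simp
    ring
  have : 0 ≤ (‖a‖ - 2 * lam * ‖b‖) ^ 2 / (4 * lam) := by positivity
  linarith

/-- Telescoping of a one-step increment bound. -/
theorem le_add_mul_sub_mul_sum {v w : ℕ → ℝ} {d η : ℝ}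
    (h : ∀ k, v (k + 1) ≤ v k + d - η * w k) (k j : ℕ) :
    v (k + j) ≤ v k + j * d - η * ∑ i ∈ Finset.range j, w (k + i) := by
  induction j with
  | zero => simp
  | succ j ih =>
    rw [Finset.sum_range_succ, ← add_assoc]
    push_cast
    linarith [h (k + j)]

/-- global state boundedness (Lemma 3(i) of the paper) for an N-step strongly
detectable, IF-OFQP(ν, ρ, δ) discrete-time trajectory with bounded input. -/
theorem stmt_3 {n m : ℕ}
    (x : ℕ → EuclideanSpace ℝ (Fin n)) (u y : ℕ → EuclideanSpace ℝ (Fin m))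
    (N : ℕ) (ϑ : ℝ) (hϑ : 0 ≤ ϑ)
    (p : EuclideanSpace ℝ (Fin n) → ℝ) (hp : ∀ z, 0 ≤ p z)
    (hdet : ∀ k₀ : ℕ,
      p (x k₀) ≤ ∑ k ∈ Finset.Icc k₀ (k₀ + N), (ϑ * ‖u k‖ ^ 2 + ‖y k‖ ^ 2))
    (V : EuclideanSpace ℝ (Fin n) → ℝ) (hV : ∀ z, 0 ≤ V z)
    (ν ρ δ : ℝ) (hρ : 0 < ρ) (hδ : 0 ≤ δ)
    (hdiss : ∀ k : ℕ, V (x (k + 1)) - V (x k) ≤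
      ⟪u k, y k⟫ - ν * ‖u k‖ ^ 2 - ρ * ‖y k‖ ^ 2 + δ)
    (U : ℝ) (hU : ∀ k, ‖u k‖ ≤ U)
    (lam : ℝ) (hlam₀ : 0 < lam) (hlamρ : lam < ρ)
    (η₁ η₂ : ℝ) (hη₁ : η₁ = 1 / (4 * lam) - ν) (hη₁pos : 0 < η₁) (hη₂ : η₂ = ρ - lam)
    (c₂ c₃ ξ₂ c₁ : ℝ)
    (hc₂ : c₂ = (N + 1) * ((η₁ + ϑ * η₂) * U ^ 2 + δ))
    (hc₃ : c₃ = (N + 1) * (η₁ * U ^ 2 + δ))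
    (hξ₂ : ξ₂ = max (p (x 0)) (c₂ / η₂))
    (hc₁ : ∀ z, p z ≤ ξ₂ → V z ≤ c₁) :
    ∀ k : ℕ, V (x k) ≤ c₁ + c₃ := by
  subst hη₂
  have hη₂pos : 0 < ρ - lam := sub_pos.2 hlamρ
  have hu (k : ℕ) : ‖u k‖ ^ 2 ≤ U ^ 2 := by
    gcongr
    exact hU k
  have hstep (k : ℕ) :
      V (x (k + 1)) ≤ V (x k) + (η₁ * U ^ 2 + δ) - (ρ - lam) * ‖y k‖ ^ 2 := by
    have hyoung := inner_le_norm_sq_div_add_mul_norm_sq (u k) (y k) hlam₀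
    have hbound := mul_le_mul_of_nonneg_left (hu k) hη₁pos.le
    have hη : η₁ * ‖u k‖ ^ 2 = 1 / (4 * lam) * ‖u k‖ ^ 2 - ν * ‖u k‖ ^ 2 := by
      rw [hη₁]; ring
    linarith [hdiss k]
  have htele := le_add_mul_sub_mul_sum (v := fun k => V (x k)) hstep
  have hd : 0 ≤ η₁ * U ^ 2 + δ := by positivity
  have hsmall (k j : ℕ) (hj : j ≤ N + 1) (hk : p (x k) ≤ ξ₂) :
      V (x (k + j)) ≤ c₁ + c₃ := by
    have hsum : 0 ≤ (ρ - lam) * ∑ i ∈ Finset.range j, ‖y (k + i)‖ ^ 2 := by positivity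
    have hjN : (j : ℝ) ≤ N + 1 := mod_cast hj
    have := mul_le_mul_of_nonneg_right hjN hd
    linarith [htele k j, hc₁ _ hk]
  have hlarge (k : ℕ) (hk : ξ₂ < p (x k)) : V (x (k + (N + 1))) ≤ V (x k) := by
    have hp_le : p (x k) ≤
        (N + 1) * (ϑ * U ^ 2) + ∑ i ∈ Finset.range (N + 1), ‖y (k + i)‖ ^ 2 := by
      calc p (x k) ≤ ∑ i ∈ Finset.Icc k (k + N), (ϑ * ‖u i‖ ^ 2 + ‖y i‖ ^ 2) := hdet k
        _ ≤ ∑ i ∈ Finset.Icc k (k + N), (ϑ * U ^ 2 + ‖y i‖ ^ 2) := by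
          gcongr with i
          exact hU i
        _ = ∑ i ∈ Finset.range (N + 1), (ϑ * U ^ 2 + ‖y (k + i)‖ ^ 2) := by
          rw [← Finset.Ico_add_one_right_eq_Icc, Finset.sum_Ico_eq_sum_range]
          congr 2
          omega
        _ = _ := by simp [Finset.sum_add_distrib]
    have hc : c₂ < p (x k) * (ρ - lam) :=
      (div_lt_iff₀ hη₂pos).1 ((hξ₂ ▸ le_max_right _ _ : c₂ / (ρ - lam) ≤ ξ₂).trans_lt hk)
    have hmul := mul_le_mul_of_nonneg_left hp_le hη₂pos.le
    have := htele k (N + 1)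
    push_cast at this
    linarith
  intro k
  induction k using Nat.strong_induction_on with
  | _ k ih =>
    rcases le_or_gt k N with hk | hk
    · simpa using hsmall 0 k (by omega) (hξ₂ ▸ le_max_left _ _)
    · obtain ⟨j, rfl⟩ := Nat.exists_eq_add_of_le' hk
      rcases le_or_gt (p (x j)) ξ₂ with hj | hj
      · exact hsmall j (N + 1) le_rfl hj
      · exact (hlarge j hj).trans (ih j (by omega))
end

section
/- Let x : ℕ → ℝⁿ, u, y : ℕ → ℝ^m be a discrete-time trajectory, and suppose: (1) ∑_{k=k₀}^{k₀+N} (ϑ‖u[k]‖² + ‖y[k]‖²) ≥ p(x[k₀]) for all k₀, with ϑ ≥ 0 and p : ℝⁿ → ℝ≥0; (2) V : ℝⁿ → ℝ≥0 satisfies V(x[k+1]) − V(x[k]) ≤ ⟨u[k], y[k]⟩ − ν‖u[k]‖² − ρ‖y[k]‖² + δ for all k, with ν ∈ ℝ, ρ > 0, δ ≥ 0; (3) ‖u[k]‖ ≤ U for all k. Let 0 < λ < ρ with η₁ := 1/(4λ) − ν > 0 and η₂ := ρ − λ. Define c₂ = (N+1)[(η₁ + ϑη₂)U² + δ], let c₅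 > 0 be arbitrary, set ξ₄ = (c₂ + c₅)/η₂, and let c₄ be any real number with V(z) ≤ c₄ for all z ∈ ℝⁿ with p(z) ≤ ξ₄. Then there exists K ∈ ℕ such that V(x[k]) ≤ c₂ + c₄ for all k ≥ K. -/
open scoped RealInnerProductSpace

theorem inner_le_young {E : Type*} [NormedAddCommGroup E] [InnerProductSpace ℝ E]
    {r : ℝ} (hr : 0 < r) (a b : E) :
    ⟪a, b⟫ ≤ 1 / (4 * r) * ‖a‖ ^ 2 + r * ‖b‖ ^ 2 := by
  refine (real_inner_le_norm a b).trans ?_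
  have h : 1 / (4 * r) * ‖a‖ ^ 2 + r * ‖b‖ ^ 2 - ‖a‖ * ‖b‖
      = (‖a‖ - 2 * r * ‖b‖) ^ 2 / (4 * r) := by
    field_simp
    ring
  have : 0 ≤ (‖a‖ - 2 * r * ‖b‖) ^ 2 / (4 * r) := by positivity
  linarith

theorem sub_le_sum_Icc {f g : ℕ → ℝ} (h : ∀ k, f (k + 1) - f k ≤ g k) (k N : ℕ) :
    f (k + (N + 1)) - f k ≤ ∑ i ∈ Finset.Icc k (k + N), g i := by
  induction N with
  | zero => simpa using h k
  | succ N ih =>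
    rw [← add_assoc k N 1, Finset.sum_Icc_succ_top (by omega)]
    have := h (k + (N + 1))
    simp only [← add_assoc] at this ih ⊢
    linarith

/-- A nonnegative sequence which, over each window of length `d`, either decreases by `c` or
ends up below `B`, is eventually below `B`. -/
theorem exists_forall_ge_le_of_le_max {f : ℕ → ℝ} (hf : ∀ k, 0 ≤ f k) {d : ℕ} (hd : 0 < d)
    {B c : ℝ} (hc : 0 < c) (h : ∀ k, f (k + d) ≤ max B (f k - c)) :
    ∃ K : ℕ, ∀ k ≥ K, f k ≤ B := by
  have iter (k i : ℕ) : f (k + d * i) ≤ max B (f k - i * c) := by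
    induction i with
    | zero => simp
    | succ i ih =>
      have hi := h (k + d * i)
      rw [Nat.mul_succ, ← add_assoc]
      push_cast
      rw [le_max_iff] at ih hi ⊢
      rcases hi with hi | hi
      · exact .inl hi
      · rcases ih with ih | ih
        · left; linarith
        · right; linarith
  obtain ⟨I, hI⟩ := exists_nat_gt ((∑ r ∈ Finset.range d, f r) / c)
  refine ⟨d * I, fun k hk => ?_⟩
  have hk' := iter (k % d) (k / d)
  rw [Nat.mod_add_div] at hk'
  refine (le_max_iff.1 hk').resolve_right fun hneg => ?_
  have hr : f (k % d) ≤ ∑ r ∈ Finset.range d, f r :=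
    Finset.single_le_sum (fun r _ => hf r) (Finset.mem_range.2 (Nat.mod_lt k hd))
  have hIk : (I : ℝ) ≤ (k / d : ℕ) := by
    exact_mod_cast (Nat.le_div_iff_mul_le hd).2 (by rwa [mul_comm])
  have hlt := (div_lt_iff₀ hc).1 hI
  have := mul_le_mul_of_nonneg_right hIk hc.le
  linarith [hf k]

/-- ultimate boundedness (Lemma 3(ii) of the paper) for an N-step strongly
detectable, IF-OFQP(ν, ρ, δ) discrete-time trajectory with bounded input. -/
theorem stmt_4 {n m : ℕ}
    (x : ℕ → EuclideanSpace ℝ (Fin n)) (u y : ℕ → EuclideanSpace ℝ (Fin m))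
    (N : ℕ) (ϑ : ℝ) (hϑ : 0 ≤ ϑ)
    (p : EuclideanSpace ℝ (Fin n) → ℝ) (hp : ∀ z, 0 ≤ p z)
    (hdet : ∀ k₀ : ℕ,
      p (x k₀) ≤ ∑ k ∈ Finset.Icc k₀ (k₀ + N), (ϑ * ‖u k‖ ^ 2 + ‖y k‖ ^ 2))
    (V : EuclideanSpace ℝ (Fin n) → ℝ) (hV : ∀ z, 0 ≤ V z)
    (ν ρ δ : ℝ) (hρ : 0 < ρ) (hδ : 0 ≤ δ)
    (hdiss : ∀ k : ℕ, V (x (k + 1)) - V (x k) ≤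
      ⟪u k, y k⟫ - ν * ‖u k‖ ^ 2 - ρ * ‖y k‖ ^ 2 + δ)
    (U : ℝ) (hU : ∀ k, ‖u k‖ ≤ U)
    (lam : ℝ) (hlam₀ : 0 < lam) (hlamρ : lam < ρ)
    (η₁ η₂ : ℝ) (hη₁ : η₁ = 1 / (4 * lam) - ν) (hη₁pos : 0 < η₁) (hη₂ : η₂ = ρ - lam)
    (c₂ c₅ ξ₄ c₄ : ℝ)
    (hc₂ : c₂ = (N + 1) * ((η₁ + ϑ * η₂) * U ^ 2 + δ))
    (hc₅ : 0 < c₅)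
    (hξ₄ : ξ₄ = (c₂ + c₅) / η₂)
    (hc₄ : ∀ z, p z ≤ ξ₄ → V z ≤ c₄) :
    ∃ K : ℕ, ∀ k ≥ K, V (x k) ≤ c₂ + c₄ := by
  have hη₂pos : 0 < η₂ := by linarith
  have hstep (k : ℕ) : V (x (k + 1)) - V (x k) ≤
      ((η₁ + ϑ * η₂) * U ^ 2 + δ) - η₂ * (ϑ * ‖u k‖ ^ 2 + ‖y k‖ ^ 2) := by
    have hin := inner_le_young hlam₀ (u k) (y k)
    have hu : ‖u k‖ ^ 2 ≤ U ^ 2 := pow_le_pow_left₀ (norm_nonneg _) (hU k) 2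
    have hcoef : 0 ≤ η₁ + ϑ * η₂ := by positivity
    have hmul := mul_le_mul_of_nonneg_left hu hcoef
    have hd := hdiss k
    have e₁ : η₁ * ‖u k‖ ^ 2 = 1 / (4 * lam) * ‖u k‖ ^ 2 - ν * ‖u k‖ ^ 2 := by rw [hη₁]; ring
    have e₂ : η₂ * ‖y k‖ ^ 2 = ρ * ‖y k‖ ^ 2 - lam * ‖y k‖ ^ 2 := by rw [hη₂]; ring
    linarith
  have hwindow (k : ℕ) : V (x (k + (N + 1))) - V (x k) ≤ c₂ - η₂ * p (x k) := by
    have hsum := sub_le_sum_Icc (f := fun k => V (x k)) hstep k N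
    rw [Finset.sum_sub_distrib, ← Finset.mul_sum, Finset.sum_const, Nat.card_Icc,
      show k + N + 1 - k = N + 1 by omega, nsmul_eq_mul] at hsum
    push_cast at hsum
    rw [← hc₂] at hsum
    linarith [mul_le_mul_of_nonneg_left (hdet k) hη₂pos.le]
  refine exists_forall_ge_le_of_le_max (fun k => hV (x k)) N.succ_pos hc₅ fun k => ?_
  have hw := hwindow k
  rw [le_max_iff]
  rcases le_or_gt (p (x k)) ξ₄ with hpk | hpk
  · left
    linarith [hc₄ _ hpk, mul_nonneg hη₂pos.le (hp (x k))]
  · right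
    rw [hξ₄, div_lt_iff₀ hη₂pos] at hpk
    simp only [Nat.succ_eq_add_one]
    linarith
end

section
/- Let f_d : ℝⁿ × ℝ^m → ℝⁿ and h_d : ℝⁿ × ℝ^m → ℝ^m be continuous. Suppose there exist λ, a, b, c > 0, d₁ ≥ 0, ϑ ≥ 0, δ ≥ 0, ν ∈ ℝ and ρ > 0 with νρ ≤ 1/4, and a continuous V : ℝⁿ → ℝ with a‖x‖^λ ≤ V(x) ≤ b‖x‖^λ + d₁ for all x, such that for all x ∈ ℝⁿ and u ∈ ℝ^m: V(f_d(x,u)) − V(x) ≤ ⟨u, h_d(x,u)⟩ − ν‖u‖² − ρ‖h_d(x,u)‖² + δ (IF-OFQP(ν, ρ, δ)) and ϑ‖u‖² + ‖h_d(x,u)‖² ≥ c‖x‖^λ (0-step strong detectability with p(x) ≥ c‖x‖^λ). Then the system x[k+1] = f_d(x[k], u[k]) is input-to-state practically stable: there exist a function β₁ : ℝ≥0 × ℕ → ℝ≥0 such that for every fixed k the map r ↦ β₁(r, k) is continuous, strictly increasing and vanishes at 0, and for every fixed r the map k ↦ β₁(r, k) is nonincreasing with β₁(r, k) → 0 as k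 → ∞; a continuous strictly increasing β₂ : ℝ≥0 → ℝ≥0 with β₂(0) = 0; and a constant d > 0, such that every solution x with x[k+1] = f_d(x[k], u[k]) and bounded input u satisfies ‖x[k]‖ ≤ β₁(‖x[0]‖, k) + β₂(max_{0 ≤ j ≤ k−1} ‖u[j]‖) + d for all k ≥ 1. -/
open scoped RealInnerProductSpace NNReal

/-- A power bound by a sum of three terms yields a bound by the sum of the roots. -/
theorem le_add_rpow_inv_of_rpow_le {t A B C p : ℝ} (hp : 0 < p) (ht : 0 ≤ t) (hA : 0 ≤ A)
    (hB : 0 ≤ B) (hC : 0 ≤ C) (h : t ^ p ≤ A + B + C) :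
    t ≤ (3 * A) ^ p⁻¹ + (3 * B) ^ p⁻¹ + (3 * C) ^ p⁻¹ := by
  have hroot : ∀ y, t ^ p ≤ y → t ≤ y ^ p⁻¹ := fun y hy =>
    (Real.le_rpow_inv_iff_of_pos ht ((Real.rpow_nonneg ht p).trans hy) hp).2 hy
  have nA : 0 ≤ (3 * A) ^ p⁻¹ := by positivity
  have nB : 0 ≤ (3 * B) ^ p⁻¹ := by positivity
  have nC : 0 ≤ (3 * C) ^ p⁻¹ := by positivity
  by_cases h1 : t ^ p ≤ 3 * A
  · linarith [hroot _ h1]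
  by_cases h2 : t ^ p ≤ 3 * B
  · linarith [hroot _ h2]
  · linarith [hroot (3 * C) (by linarith)]

/-- A discrete Grönwall bound for a contractive scalar recursion. -/
theorem le_pow_mul_add_div_of_le_mul_add {v : ℕ → ℝ} {q E : ℝ} {k : ℕ} (hq : 0 ≤ q) (hq1 : q < 1)
    (hE : 0 ≤ E) (h : ∀ j < k, v (j + 1) ≤ q * v j + E) :
    v k ≤ q ^ k * v 0 + E / (1 - q) := by
  have h1 : 0 < 1 - q := by linarith
  induction k with
  | zero =>
    have : 0 ≤ E / (1 - q) := by positivity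
    simpa using this
  | succ k ih =>
    have ih' := mul_le_mul_of_nonneg_left (ih fun j hj => h j (by omega)) hq
    have hk := h k (by omega)
    have e : q * (E / (1 - q)) + E = E / (1 - q) := by field_simp; ring
    calc v (k + 1) ≤ q * (q ^ k * v 0 + E / (1 - q)) + E := by linarith
      _ = q ^ (k + 1) * v 0 + (q * (E / (1 - q)) + E) := by ring
      _ = _ := by rw [e]

/-- Young's inequality turns the supply rate into an input gain minus an output penalty. -/
theorem inner_sub_sub_le_sq {F : Type*} [NormedAddCommGroup F] [InnerProductSpace ℝ F] (w y : F)
    (ν : ℝ) {ρ : ℝ} (hρ : 0 < ρ) :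
    ⟪w, y⟫ - ν * ‖w‖ ^ 2 - ρ * ‖y‖ ^ 2 ≤ (1 / (2 * ρ) + |ν|) * ‖w‖ ^ 2 - ρ / 2 * ‖y‖ ^ 2 := by
  have h1 := real_inner_le_norm w y
  have h2 : ‖w‖ * ‖y‖ ≤ 1 / (2 * ρ) * ‖w‖ ^ 2 + ρ / 2 * ‖y‖ ^ 2 := by
    have e : 1 / (2 * ρ) * ‖w‖ ^ 2 + ρ / 2 * ‖y‖ ^ 2 - ‖w‖ * ‖y‖
        = 1 / (2 * ρ) * (‖w‖ - ρ * ‖y‖) ^ 2 := by field_simp; ring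
    have : 0 ≤ 1 / (2 * ρ) * (‖w‖ - ρ * ‖y‖) ^ 2 := by positivity
    linarith
  have h3 : -ν * ‖w‖ ^ 2 ≤ |ν| * ‖w‖ ^ 2 :=
    mul_le_mul_of_nonneg_right (neg_le_abs ν) (sq_nonneg _)
  linarith

/-- a 0-step strongly detectable, IF-OFQP(ν, ρ, δ) discrete-time control
system with a sandwiched storage function is input-to-state practically stable (ISpS). -/
theorem stmt_5 {n m : ℕ}
    (fd : EuclideanSpace ℝ (Fin n) → EuclideanSpace ℝ (Fin m) → EuclideanSpace ℝ (Fin n))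
    (hd : EuclideanSpace ℝ (Fin n) → EuclideanSpace ℝ (Fin m) → EuclideanSpace ℝ (Fin m))
    (hfd : Continuous fun z : EuclideanSpace ℝ (Fin n) × EuclideanSpace ℝ (Fin m) => fd z.1 z.2)
    (hhd : Continuous fun z : EuclideanSpace ℝ (Fin n) × EuclideanSpace ℝ (Fin m) => hd z.1 z.2)
    (lam a b c d₁ ϑ δ ν ρ : ℝ)
    (hlam : 0 < lam) (ha : 0 < a) (hb : 0 < b) (hc : 0 < c) (hd₁ : 0 ≤ d₁)
    (hϑ : 0 ≤ ϑ) (hδ : 0 ≤ δ) (hρ : 0 < ρ) (hνρ : ν * ρ ≤ 1 / 4)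
    (V : EuclideanSpace ℝ (Fin n) → ℝ) (hVcont : Continuous V)
    (hVlow : ∀ z, a * ‖z‖ ^ lam ≤ V z) (hVup : ∀ z, V z ≤ b * ‖z‖ ^ lam + d₁)
    (hdiss : ∀ z w, V (fd z w) - V z ≤ ⟪w, hd z w⟫ - ν * ‖w‖ ^ 2 - ρ * ‖hd z w‖ ^ 2 + δ)
    (hdet : ∀ z w, c * ‖z‖ ^ lam ≤ ϑ * ‖w‖ ^ 2 + ‖hd z w‖ ^ 2) :
    ∃ (β₁ : ℝ≥0 → ℕ → ℝ≥0) (β₂ : ℝ≥0 → ℝ≥0) (d : ℝ),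
      (∀ k, Continuous fun r => β₁ r k) ∧
      (∀ k, StrictMono fun r => β₁ r k) ∧
      (∀ k, β₁ 0 k = 0) ∧
      (∀ r, Antitone fun k => β₁ r k) ∧
      (∀ r, Filter.Tendsto (fun k => β₁ r k) Filter.atTop (nhds 0)) ∧
      Continuous β₂ ∧ StrictMono β₂ ∧ β₂ 0 = 0 ∧ 0 < d ∧
      ∀ (x : ℕ → EuclideanSpace ℝ (Fin n)) (u : ℕ → EuclideanSpace ℝ (Fin m)),
        (∀ k, x (k + 1) = fd (x k) (u k)) → (∃ M, ∀ k, ‖u k‖ ≤ M) →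
        ∀ k : ℕ, ∀ hk : 1 ≤ k,
          ‖x k‖ ≤ (β₁ ‖x 0‖₊ k : ℝ) +
            (β₂ ((Finset.range k).sup'
                (Finset.nonempty_range_iff.mpr (Nat.one_le_iff_ne_zero.mp hk))
                fun j => ‖u j‖₊) : ℝ) + d := by
  obtain ⟨q, hq0, hq1, hqr⟩ : ∃ q : ℝ, 0 < q ∧ q < 1 ∧ 1 - ρ * c / (2 * b) ≤ q :=
    ⟨max (1 - ρ * c / (2 * b)) (1 / 2), by positivity,
      max_lt (by linarith [show 0 < ρ * c / (2 * b) by positivity]) (by norm_num), le_max_left _ _⟩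
  set G : ℝ := 1 / (2 * ρ) + |ν| + ρ / 2 * ϑ with hG
  have hGpos : 0 < G := by positivity
  set D : ℝ := δ + ρ * c / (2 * b) * d₁ with hD
  have hDnn : 0 ≤ D := by positivity
  have h1q : 0 < 1 - q := by linarith
  have hVnn : ∀ z, 0 ≤ V z := fun z => le_trans (by positivity) (hVlow z)
  have hstep : ∀ z w, V (fd z w) ≤ q * V z + (G * ‖w‖ ^ 2 + D) := by
    intro z w
    have h1 := hdiss z w
    have h2 := inner_sub_sub_le_sq w (hd z w) ν hρ
    have h3 := mul_le_mul_of_nonneg_left (hdet z w) (show 0 ≤ ρ / 2 by positivity)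
    have h4 := mul_le_mul_of_nonneg_left (hVup z) (show 0 ≤ ρ * c / (2 * b) by positivity)
    have e : ρ * c / (2 * b) * (b * ‖z‖ ^ lam + d₁)
        = ρ / 2 * (c * ‖z‖ ^ lam) + ρ * c / (2 * b) * d₁ := by field_simp
    rw [e] at h4
    have h5 := mul_le_mul_of_nonneg_right hqr (hVnn z)
    rw [hG, hD]
    linarith
  set p : ℝ := q ^ lam⁻¹ with hp
  have hp0 : 0 < p := Real.rpow_pos_of_pos hq0 _
  have hp1 : p < 1 := Real.rpow_lt_one hq0.le hq1 (inv_pos.2 hlam)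
  set C₁ : ℝ := (3 * (b / a)) ^ lam⁻¹ with hC₁
  have hC₁pos : 0 < C₁ := by positivity
  set C₂ : ℝ := (3 * (G / (1 - q) / a)) ^ lam⁻¹ with hC₂
  have hC₂pos : 0 < C₂ := by positivity
  set C₃ : ℝ := (d₁ + D / (1 - q)) / a with hC₃
  have hC₃nn : 0 ≤ C₃ := by positivity
  have hexp : 0 < 2 * lam⁻¹ := by positivity
  lift p to ℝ≥0 using hp0.le with p'
  lift C₁ to ℝ≥0 using hC₁pos.le with C₁'
  lift C₂ to ℝ≥0 using hC₂pos.le with C₂'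
  norm_cast at hp0 hp1 hC₁pos hC₂pos
  refine ⟨fun r k => C₁' * p' ^ k * r, fun r => C₂' * r ^ (2 * lam⁻¹), (3 * C₃) ^ lam⁻¹ + 1,
    fun k => by fun_prop, fun k r s hrs => ?_, fun k => by simp, fun r k l hkl => ?_, fun r => ?_,
    ?_, fun r s hrs => ?_, ?_, by positivity, ?_⟩
  · exact mul_lt_mul_of_pos_left hrs (by positivity)
  · have := pow_le_pow_of_le_one hp0.le hp1.le hkl
    dsimp only
    gcongr
  · simpa using ((tendsto_pow_atTop_nhds_zero_of_lt_one hp0.le hp1).const_mul C₁').mul_const r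
  · exact continuous_const.mul (NNReal.continuous_rpow_const hexp.le)
  · exact mul_lt_mul_of_pos_left (NNReal.rpow_lt_rpow hrs hexp) hC₂pos
  · simp [NNReal.zero_rpow hexp.ne']
  intro x u hx _ k hk
  set U : ℝ≥0 := (Finset.range k).sup' (Finset.nonempty_range_iff.mpr
    (Nat.one_le_iff_ne_zero.mp hk)) fun j => ‖u j‖₊ with hU
  have hu : ∀ j < k, ‖u j‖ ≤ U := fun j hj => by
    have : ‖u j‖₊ ≤ U := Finset.le_sup' (fun j => ‖u j‖₊) (Finset.mem_range.2 hj)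
    exact_mod_cast this
  have hrec : ∀ j < k, V (x (j + 1)) ≤ q * V (x j) + (G * (U : ℝ) ^ 2 + D) := fun j hj => by
    have h1 := hstep (x j) (u j)
    rw [← hx] at h1
    have h2 : G * ‖u j‖ ^ 2 ≤ G * (U : ℝ) ^ 2 := by
      have := hu j hj
      gcongr
    linarith
  have hV := le_pow_mul_add_div_of_le_mul_add (v := fun j => V (x j)) hq0.le hq1
    (show 0 ≤ G * (U : ℝ) ^ 2 + D by positivity) hrec
  have hqk : q ^ k * V (x 0) ≤ q ^ k * (b * ‖x 0‖ ^ lam) + d₁ := by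
    have h1 := mul_le_mul_of_nonneg_left (hVup (x 0)) (pow_nonneg hq0.le k)
    have h2 := mul_le_mul_of_nonneg_right (pow_le_one₀ (n := k) hq0.le hq1.le) hd₁
    linarith
  have hpow : ‖x k‖ ^ lam ≤ q ^ k * (b / a) * ‖x 0‖ ^ lam + G / (1 - q) / a * (U : ℝ) ^ 2 + C₃ := by
    have h1 : a * ‖x k‖ ^ lam ≤ a * (q ^ k * (b / a) * ‖x 0‖ ^ lam
        + G / (1 - q) / a * (U : ℝ) ^ 2 + C₃) := by
      have e : a * (q ^ k * (b / a) * ‖x 0‖ ^ lam + G / (1 - q) / a * (U : ℝ) ^ 2 + C₃)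
          = q ^ k * (b * ‖x 0‖ ^ lam) + d₁ + (G * (U : ℝ) ^ 2 + D) / (1 - q) := by
        rw [hC₃]; field_simp; ring
      rw [e]
      exact (hVlow _).trans (by linarith)
    exact le_of_mul_le_mul_left h1 ha
  have hfin := le_add_rpow_inv_of_rpow_le hlam (norm_nonneg _) (by positivity) (by positivity)
    hC₃nn hpow
  have e₁ : (3 * (q ^ k * (b / a) * ‖x 0‖ ^ lam)) ^ lam⁻¹ = C₁' * (p' : ℝ) ^ k * ‖x 0‖ := by
    rw [show 3 * (q ^ k * (b / a) * ‖x 0‖ ^ lam) = 3 * (b / a) * q ^ k * ‖x 0‖ ^ lam by ring,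
      Real.mul_rpow (by positivity) (by positivity), Real.mul_rpow (by positivity) (by positivity),
      Real.rpow_rpow_inv (norm_nonneg _) hlam.ne', hC₁, hp, Real.rpow_pow_comm hq0.le]
  have e₂ : (3 * (G / (1 - q) / a * (U : ℝ) ^ 2)) ^ lam⁻¹ = C₂' * (U : ℝ) ^ (2 * lam⁻¹) := by
    rw [← mul_assoc, Real.mul_rpow (by positivity) (by positivity), hC₂,
      Real.rpow_mul U.coe_nonneg, Real.rpow_two]
  rw [e₁, e₂] at hfin
  push_cast
  linarith
end

section
/- Let τ > 0, γ > 0, λ₁ > 0, ν, ρ ∈ ℝ, and k₀ < k₁ in ℕ. Let (u_k)_{k∈ℕ} be a sequence in ℝ^m and define the piecewise-constant input u : ℝ≥0 → ℝ^m by u(t) = u_k for t ∈ [kτ, (k+1)τ). Let x : ℝ≥0 → ℝⁿ be continuous, h₁ : ℝⁿ → ℝ^m be such that g(t) := h₁(x(t)) is continuously differentiable, h₂ : ℝ^m → ℝ^m, and define the continuous-time output y(t) = g(t) + h₂(u(t)) and the sampled output y_k = g(kτ) + h₂(u_k). Assume: (a) V : ℝⁿ → ℝ≥0 satisfies the integral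 dissipation inequality V(x(t₁)) − V(x(t₀)) ≤ ∫_{t₀}^{t₁} (⟨u(t), y(t)⟩ − ν‖u(t)‖² − ρ‖y(t)‖²) dt for all 0 ≤ t₀ ≤ t₁; (b) (gain condition) β : ℝⁿ → ℝ≥0 satisfies ∫_{t₀}^{t₁} ‖g′(t)‖² dt ≤ γ² ∫_{t₀}^{t₁} ‖u(t)‖² dt + β(x(t₀)) for all 0 ≤ t₀ ≤ t₁. Then, with ν′ = ν − τγ − τ²γ²(1+λ₁)|ρ|, ρ′ = ρ − |ρ|/λ₁, and w = |ρ|τ(1+λ₁) + 1/γ, the sampled system satisfies (1/τ)V(x(k₁τ)) − (1/τ)V(x(k₀τ)) ≤ w·β(x(k₀τ)) + ∑_{k=k₀}^{k₁−1} (⟨u_k, y_k⟩ − ν′‖u_k‖² − ρ′‖y_k‖²). -/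
open scoped RealInnerProductSpace

open MeasureTheory Set

/-- Perturbing the output by `d` changes the IF-OFP supply by at most quadratic terms. -/
lemma supply_add_le {E : Type*} [NormedAddCommGroup E] [InnerProductSpace ℝ E]
    (v y d : E) (ν ρ : ℝ) {c l : ℝ} (hc : 0 < c) (hl : 0 < l) :
    ⟪v, y + d⟫ - ν * ‖v‖ ^ 2 - ρ * ‖y + d‖ ^ 2 ≤
      ⟪v, y⟫ - ν * ‖v‖ ^ 2 - ρ * ‖y‖ ^ 2 + c / 2 * ‖v‖ ^ 2 + |ρ| / l * ‖y‖ ^ 2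
        + (1 / (2 * c) + |ρ| * (1 + l)) * ‖d‖ ^ 2 := by
  have hvd : ⟪v, d⟫ ≤ c / 2 * ‖v‖ ^ 2 + 1 / (2 * c) * ‖d‖ ^ 2 := by
    refine (real_inner_le_norm v d).trans ?_
    have h : c / 2 * ‖v‖ ^ 2 + 1 / (2 * c) * ‖d‖ ^ 2 - ‖v‖ * ‖d‖
        = (c * ‖v‖ - ‖d‖) ^ 2 / (2 * c) := by
      field_simp
      ring
    have : 0 ≤ (c * ‖v‖ - ‖d‖) ^ 2 / (2 * c) := by positivity
    linarith
  have hyd : 2 * |⟪y, d⟫| ≤ ‖y‖ ^ 2 / l + l * ‖d‖ ^ 2 := by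
    have h : ‖y‖ ^ 2 / l + l * ‖d‖ ^ 2 - 2 * (‖y‖ * ‖d‖) = (‖y‖ - l * ‖d‖) ^ 2 / l := by
      field_simp
      ring
    have : 0 ≤ (‖y‖ - l * ‖d‖) ^ 2 / l := by positivity
    linarith [abs_real_inner_le_norm y d]
  have hρ : -(ρ * (2 * ⟪y, d⟫ + ‖d‖ ^ 2)) ≤ |ρ| * (‖y‖ ^ 2 / l + (1 + l) * ‖d‖ ^ 2) := by
    refine (neg_le_abs _).trans ?_
    rw [abs_mul]
    refine mul_le_mul_of_nonneg_left ((abs_add_le _ _).trans ?_) (abs_nonneg ρ)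
    rw [abs_mul, abs_two, abs_of_nonneg (sq_nonneg ‖d‖)]
    linarith
  rw [inner_add_right, norm_add_sq_real]
  have e : |ρ| / l * ‖y‖ ^ 2 = |ρ| * (‖y‖ ^ 2 / l) := by ring
  rw [e]
  linarith

/-- Cauchy–Schwarz bound for the increment of a `C¹` curve on an interval of length at most `L`. -/
lemma norm_sub_sq_le_mul_integral {E : Type*} [NormedAddCommGroup E] [NormedSpace ℝ E]
    [CompleteSpace E] {f f' : ℝ → E} (hf : ∀ t, HasDerivAt f (f' t) t) (hf' : Continuous f')
    {a t L : ℝ} (hat : a ≤ t) (htL : t ≤ a + L) (hL : 0 < L) :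
    ‖f t - f a‖ ^ 2 ≤ L * ∫ s in a..a + L, ‖f' s‖ ^ 2 := by
  have hM : ‖f t - f a‖ ≤ ∫ s in a..t, ‖f' s‖ := by
    rw [← intervalIntegral.integral_eq_sub_of_hasDerivAt (fun s _ => hf s)
      (hf'.intervalIntegrable _ _)]
    exact intervalIntegral.norm_integral_le_integral_norm hat
  set M := ∫ s in a..t, ‖f' s‖ with hMdef
  have hsq : 0 ≤ ∫ s in a..t, (‖f' s‖ - M / L) ^ 2 :=
    intervalIntegral.integral_nonneg hat fun s _ => sq_nonneg _
  have hexp : ∫ s in a..t, (‖f' s‖ - M / L) ^ 2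
      = (∫ s in a..t, ‖f' s‖ ^ 2) - 2 * (M / L) * M + (t - a) * (M / L) ^ 2 := by
    have e : (fun s => (‖f' s‖ - M / L) ^ 2)
        = fun s => ‖f' s‖ ^ 2 - 2 * (M / L) * ‖f' s‖ + (M / L) ^ 2 := by
      ext s
      ring
    rw [e, intervalIntegral.integral_add, intervalIntegral.integral_sub,
      intervalIntegral.integral_const_mul, intervalIntegral.integral_const, smul_eq_mul]
    all_goals exact Continuous.intervalIntegrable (by fun_prop) _ _
  have hmono : ∫ s in a..t, ‖f' s‖ ^ 2 ≤ ∫ s in a..a + L, ‖f' s‖ ^ 2 :=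
    intervalIntegral.integral_mono_interval le_rfl hat htL
      (Filter.Eventually.of_forall fun s => sq_nonneg _)
      (Continuous.intervalIntegrable (by fun_prop) _ _)
  have hlen : (t - a) * (M / L) ^ 2 ≤ L * (M / L) ^ 2 :=
    mul_le_mul_of_nonneg_right (by linarith) (sq_nonneg _)
  have hML : M / L * L = M := div_mul_cancel₀ M hL.ne'
  have hM2 : L * (M / L) ^ 2 ≤ ∫ s in a..a + L, ‖f' s‖ ^ 2 := by
    have e : 2 * (M / L) * M = 2 * (L * (M / L) ^ 2) := by
      field_simp
    linarith
  calc ‖f t - f a‖ ^ 2 ≤ M ^ 2 := pow_le_pow_left₀ (norm_nonneg _) hM 2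
    _ = L * (L * (M / L) ^ 2) := by field_simp
    _ ≤ _ := mul_le_mul_of_nonneg_left hM2 hL.le

/-- On an interval where the input is constant, the integrated supply is bounded by the supply
sampled at the left endpoint plus quadratic corrections. -/
lemma integral_supply_le {E : Type*} [NormedAddCommGroup E] [InnerProductSpace ℝ E]
    [CompleteSpace E] {f f' u : ℝ → E} {h : E → E} {v : E} {a L c l : ℝ} (ν ρ : ℝ)
    (hf : ∀ t, HasDerivAt f (f' t) t) (hf' : Continuous f')
    (hu : ∀ t ∈ Ioo a (a + L), u t = v) (hL : 0 < L) (hc : 0 < c) (hl : 0 < l) :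
    ∫ t in a..a + L, (⟪u t, f t + h (u t)⟫ - ν * ‖u t‖ ^ 2 - ρ * ‖f t + h (u t)‖ ^ 2) ≤
      L * (⟪v, f a + h v⟫ - ν * ‖v‖ ^ 2 - ρ * ‖f a + h v‖ ^ 2 + c / 2 * ‖v‖ ^ 2
        + |ρ| / l * ‖f a + h v‖ ^ 2
        + (1 / (2 * c) + |ρ| * (1 + l)) * (L * ∫ s in a..a + L, ‖f' s‖ ^ 2)) := by
  have hfc : Continuous f := continuous_iff_continuousAt.2 fun t => (hf t).continuousAt
  have haL : a ≤ a + L := by linarith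
  rw [intervalIntegral.integral_congr_Ioo_of_le (g := fun t =>
    ⟪v, f t + h v⟫ - ν * ‖v‖ ^ 2 - ρ * ‖f t + h v‖ ^ 2) haL
    (fun t ht => by simp only [hu t ht])]
  set C := ⟪v, f a + h v⟫ - ν * ‖v‖ ^ 2 - ρ * ‖f a + h v‖ ^ 2 + c / 2 * ‖v‖ ^ 2
        + |ρ| / l * ‖f a + h v‖ ^ 2
        + (1 / (2 * c) + |ρ| * (1 + l)) * (L * ∫ s in a..a + L, ‖f' s‖ ^ 2) with hC
  have hconst : ∫ _ in a..a + L, C = L * C := by simp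
  rw [← hconst]
  refine intervalIntegral.integral_mono_on haL
    (Continuous.intervalIntegrable (by fun_prop) _ _) intervalIntegrable_const fun t ht => ?_
  have hs := supply_add_le v (f a + h v) (f t - f a) ν ρ hc hl
  have e : f a + h v + (f t - f a) = f t + h v := by abel
  rw [e] at hs
  refine hs.trans ?_
  rw [hC]
  gcongr
  exact norm_sub_sq_le_mul_integral hf hf' ht.1 ht.2 hL

/-- passivity degradation under sampling (Theorem 1 of the paper). The
continuous-time system with output `y(t) = h₁(x(t)) + h₂(u(t))` is IF-OFP(ν, ρ) and
satisfies the gain condition; its zero-order-hold sampled model with period τ satisfies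
the degraded passivity inequality with indices ν′, ρ′ and bias `w · β(x(k₀τ))`. -/
theorem stmt_6 {n m : ℕ}
    (τ γ lam₁ ν ρ : ℝ) (hτ : 0 < τ) (hγ : 0 < γ) (hlam₁ : 0 < lam₁)
    (k₀ k₁ : ℕ) (hk : k₀ < k₁)
    (useq : ℕ → EuclideanSpace ℝ (Fin m)) (u : ℝ → EuclideanSpace ℝ (Fin m))
    (hu : ∀ k : ℕ, ∀ t ∈ Set.Ico ((k : ℝ) * τ) (((k : ℝ) + 1) * τ), u t = useq k)
    (x : ℝ → EuclideanSpace ℝ (Fin n)) (hx : Continuous x)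
    (h₁ : EuclideanSpace ℝ (Fin n) → EuclideanSpace ℝ (Fin m))
    (h₂ : EuclideanSpace ℝ (Fin m) → EuclideanSpace ℝ (Fin m))
    (g' : ℝ → EuclideanSpace ℝ (Fin m))
    (hg : ∀ t : ℝ, HasDerivAt (fun s => h₁ (x s)) (g' t) t) (hg'c : Continuous g')
    (V : EuclideanSpace ℝ (Fin n) → ℝ) (hV : ∀ z, 0 ≤ V z)
    (β : EuclideanSpace ℝ (Fin n) → ℝ) (hβ : ∀ z, 0 ≤ β z)
    (hdiss : ∀ t₀ t₁ : ℝ, 0 ≤ t₀ → t₀ ≤ t₁ →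
      V (x t₁) - V (x t₀) ≤ ∫ t in t₀..t₁,
        (⟪u t, h₁ (x t) + h₂ (u t)⟫ - ν * ‖u t‖ ^ 2 - ρ * ‖h₁ (x t) + h₂ (u t)‖ ^ 2))
    (hgain : ∀ t₀ t₁ : ℝ, 0 ≤ t₀ → t₀ ≤ t₁ →
      (∫ t in t₀..t₁, ‖g' t‖ ^ 2) ≤ γ ^ 2 * (∫ t in t₀..t₁, ‖u t‖ ^ 2) + β (x t₀)) :
    (1 / τ) * V (x ((k₁ : ℝ) * τ)) - (1 / τ) * V (x ((k₀ : ℝ) * τ)) ≤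
      (|ρ| * τ * (1 + lam₁) + 1 / γ) * β (x ((k₀ : ℝ) * τ)) +
      ∑ k ∈ Finset.Ico k₀ k₁,
        (⟪useq k, h₁ (x ((k : ℝ) * τ)) + h₂ (useq k)⟫
          - (ν - τ * γ - τ ^ 2 * γ ^ 2 * (1 + lam₁) * |ρ|) * ‖useq k‖ ^ 2
          - (ρ - |ρ| / lam₁) * ‖h₁ (x ((k : ℝ) * τ)) + h₂ (useq k)‖ ^ 2) := by
  have hnode : ∀ k : ℕ, ((k + 1 : ℕ) : ℝ) * τ = (k : ℝ) * τ + τ := fun k => by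
    push_cast
    ring
  have hnn : ∀ k : ℕ, (0 : ℝ) ≤ (k : ℝ) * τ := fun k => by positivity
  have hu' : ∀ k : ℕ, ∀ t ∈ Ioo ((k : ℝ) * τ) ((k : ℝ) * τ + τ), u t = useq k :=
    fun k t ht => hu k t ⟨ht.1.le, by linarith [ht.2]⟩
  have hle : ∀ k : ℕ, (k : ℝ) * τ ≤ (k : ℝ) * τ + τ := fun k => by linarith
  set D : ℕ → ℝ := fun k => ∫ s in (k : ℝ) * τ..(k : ℝ) * τ + τ, ‖g' s‖ ^ 2 with hD
  set y : ℕ → EuclideanSpace ℝ (Fin m) := fun k => h₁ (x ((k : ℝ) * τ)) + h₂ (useq k) with hy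
  have hstep : ∀ k : ℕ, V (x (((k + 1 : ℕ) : ℝ) * τ)) - V (x ((k : ℝ) * τ)) ≤
      τ * (⟪useq k, y k⟫ - ν * ‖useq k‖ ^ 2 - ρ * ‖y k‖ ^ 2 + τ * γ / 2 * ‖useq k‖ ^ 2
        + |ρ| / lam₁ * ‖y k‖ ^ 2
        + (1 / (2 * (τ * γ)) + |ρ| * (1 + lam₁)) * (τ * D k)) := fun k => by
    rw [hnode]
    exact (hdiss _ _ (hnn k) (hle k)).trans
      (integral_supply_le ν ρ hg hg'c (hu' k) hτ (mul_pos hτ hγ) hlam₁)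
  have hV_sum : V (x ((k₁ : ℝ) * τ)) - V (x ((k₀ : ℝ) * τ)) ≤
      ∑ k ∈ Finset.Ico k₀ k₁, τ * (⟪useq k, y k⟫ - ν * ‖useq k‖ ^ 2 - ρ * ‖y k‖ ^ 2
        + τ * γ / 2 * ‖useq k‖ ^ 2 + |ρ| / lam₁ * ‖y k‖ ^ 2
        + (1 / (2 * (τ * γ)) + |ρ| * (1 + lam₁)) * (τ * D k)) := by
    rw [← Finset.sum_Ico_sub (fun k : ℕ => V (x ((k : ℝ) * τ))) hk.le]
    exact Finset.sum_le_sum fun k _ => hstep k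
  have hD_sum : ∑ k ∈ Finset.Ico k₀ k₁, D k
      = ∫ s in (k₀ : ℝ) * τ..(k₁ : ℝ) * τ, ‖g' s‖ ^ 2 := by
    rw [← intervalIntegral.sum_integral_adjacent_intervals_Ico
      (a := fun k : ℕ => (k : ℝ) * τ) hk.le
      (fun k _ => Continuous.intervalIntegrable (by fun_prop) _ _)]
    simp only [hnode, hD]
  have hu_sum : ∫ s in (k₀ : ℝ) * τ..(k₁ : ℝ) * τ, ‖u s‖ ^ 2
      = τ * ∑ k ∈ Finset.Ico k₀ k₁, ‖useq k‖ ^ 2 := by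
    have hcongr : ∀ k : ℕ, (uIoo ((k : ℝ) * τ) ((k : ℝ) * τ + τ)).EqOn
        (fun s => ‖u s‖ ^ 2) (fun _ => ‖useq k‖ ^ 2) := fun k s hs => by
      rw [uIoo_of_le (hle k)] at hs
      simp only [hu' k s hs]
    rw [← intervalIntegral.sum_integral_adjacent_intervals_Ico
      (a := fun k : ℕ => (k : ℝ) * τ) hk.le, Finset.mul_sum]
    · refine Finset.sum_congr rfl fun k _ => ?_
      simp only [hnode]
      rw [intervalIntegral.integral_congr_uIoo (hcongr k)]
      simp
    · intro k _
      simp only [hnode]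
      exact (intervalIntegrable_congr_uIoo (hcongr k)).2 intervalIntegrable_const
  have hgain' := hgain ((k₀ : ℝ) * τ) ((k₁ : ℝ) * τ) (hnn k₀)
    (mul_le_mul_of_nonneg_right (by exact_mod_cast hk.le) hτ.le)
  rw [← hD_sum, hu_sum] at hgain'
  set S := ∑ k ∈ Finset.Ico k₀ k₁, ‖useq k‖ ^ 2 with hS
  have hβ₀ := hβ (x ((k₀ : ℝ) * τ))
  set b := β (x ((k₀ : ℝ) * τ))
  rw [← Finset.mul_sum] at hV_sum
  have hdiv : (1 / τ) * V (x ((k₁ : ℝ) * τ)) - (1 / τ) * V (x ((k₀ : ℝ) * τ)) ≤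
      ∑ k ∈ Finset.Ico k₀ k₁, (⟪useq k, y k⟫ - ν * ‖useq k‖ ^ 2 - ρ * ‖y k‖ ^ 2
        + τ * γ / 2 * ‖useq k‖ ^ 2 + |ρ| / lam₁ * ‖y k‖ ^ 2
        + (1 / (2 * (τ * γ)) + |ρ| * (1 + lam₁)) * (τ * D k)) := by
    rw [← mul_sub, one_div, inv_mul_le_iff₀ hτ]
    exact hV_sum
  refine hdiv.trans ?_
  have hw : 0 ≤ 1 / (2 * γ) + |ρ| * (1 + lam₁) * τ := by positivity
  have hmul := mul_le_mul_of_nonneg_left hgain' hw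
  have hbγ : 1 / (2 * γ) * b ≤ 1 / γ * b := by
    refine mul_le_mul_of_nonneg_right ?_ hβ₀
    exact one_div_le_one_div_of_le hγ (by linarith)
  have hlhs : ∑ k ∈ Finset.Ico k₀ k₁, (⟪useq k, y k⟫ - ν * ‖useq k‖ ^ 2 - ρ * ‖y k‖ ^ 2
        + τ * γ / 2 * ‖useq k‖ ^ 2 + |ρ| / lam₁ * ‖y k‖ ^ 2
        + (1 / (2 * (τ * γ)) + |ρ| * (1 + lam₁)) * (τ * D k))
      = ∑ k ∈ Finset.Ico k₀ k₁, (⟪useq k, y k⟫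
          - (ν - τ * γ - τ ^ 2 * γ ^ 2 * (1 + lam₁) * |ρ|) * ‖useq k‖ ^ 2
          - (ρ - |ρ| / lam₁) * ‖y k‖ ^ 2)
        - (τ * γ / 2 + τ ^ 2 * γ ^ 2 * (1 + lam₁) * |ρ|) * S
        + (1 / (2 * γ) + |ρ| * (1 + lam₁) * τ) * ∑ k ∈ Finset.Ico k₀ k₁, D k := by
    rw [hS, Finset.mul_sum, Finset.mul_sum, ← Finset.sum_sub_distrib, ← Finset.sum_add_distrib]
    refine Finset.sum_congr rfl fun k _ => ?_
    field_simp
    ring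
  have hrhs : (1 / (2 * γ) + |ρ| * (1 + lam₁) * τ) * (γ ^ 2 * (τ * S) + b)
      = (τ * γ / 2 + τ ^ 2 * γ ^ 2 * (1 + lam₁) * |ρ|) * S
        + 1 / (2 * γ) * b + |ρ| * τ * (1 + lam₁) * b := by
    field_simp
    ring
  rw [hlhs]
  linarith
end

section
/- Let x₁ : ℕ → ℝ^{n₁}, x₂ : ℕ → ℝ^{n₂}, and u₁, y₁, ũ₂, ỹ₂, r₁, r₂ : ℕ → ℝ^m be sequences with interconnection u₁[k] = r₁[k] − ỹ₂[k] and ũ₂[k] = r₂[k] + y₁[k] for all k. Let V₁ : ℝ^{n₁} → ℝ, V₂ : ℝ^{n₂} → ℝ, δ₁ : ℝ^{n₁} → ℝ≥0, δ₂ : ℝ^{n₂} → ℝ≥0, δ̃₂ ≥ 0, and ν₁′, ρ₁′, ν̃₂, ρ̃₂ ∈ ℝ. Assume for all k₀ < k₁: V₁(x₁[k₁]) − V₁(x₁[k₀]) ≤ δ₁(x₁[k₀]) + ∑_{k=k₀}^{k₁−1} (⟨u₁[k], y₁[k]⟩ − ν₁′‖u₁[k]‖² − ρ₁′‖y₁[k]‖²)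 and V₂(x₂[k₁]) − V₂(x₂[k₀]) ≤ δ₂(x₂[k₀]) + ∑_{k=k₀}^{k₁−1} (⟨ũ₂[k], ỹ₂[k]⟩ − ν̃₂‖ũ₂[k]‖² − ρ̃₂‖ỹ₂[k]‖² + δ̃₂). Let ν̂ < min{ν₁′, ν̃₂} and ρ̂ ≤ min{ρ₁′ − ν̂ν̃₂/(ν̃₂ − ν̂), ρ̃₂ − ν̂ν₁′/(ν₁′ − ν̂)}. Then with V(x₁, x₂) := V₁(x₁) + V₂(x₂), r[k] = (r₁[k], r₂[k]) ∈ ℝ^{2m}, y[k] = (y₁[k], ỹ₂[k]) ∈ ℝ^{2m}, for all k₀ < k₁: V(x₁[k₁], x₂[k₁]) − V(x₁[k₀], x₂[k₀]) ≤ δ₁(x₁[k₀]) + δ₂(x₂[k₀]) + ∑_{k=k₀}^{k₁−1} (⟨r[k], y[k]⟩ − ν̂‖r[k]‖² − ρ̂‖y[k]‖² + δ̃₂). -/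
open scoped RealInnerProductSpace

/-- A weighted parallelogram-type bound, obtained by completing the square in
`‖(b - a) • u - a • t‖ ^ 2`. -/
theorem mul_norm_add_sq_le {E : Type*} [NormedAddCommGroup E] [InnerProductSpace ℝ E]
    {a b : ℝ} (hab : a < b) (u t : E) :
    a * ‖u + t‖ ^ 2 ≤ b * ‖u‖ ^ 2 + a * b / (b - a) * ‖t‖ ^ 2 := by
  have hd : 0 < b - a := sub_pos.mpr hab
  have hsq : 0 ≤ ‖(b - a) • u - a • t‖ ^ 2 := sq_nonneg _
  rw [norm_sub_sq_real, inner_smul_left, inner_smul_right, norm_smul, norm_smul, mul_pow,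
    mul_pow, Real.norm_eq_abs, Real.norm_eq_abs, sq_abs, sq_abs, conj_trivial] at hsq
  have key : b * ‖u‖ ^ 2 + a * b / (b - a) * ‖t‖ ^ 2 - a * ‖u + t‖ ^ 2 =
      ((b - a) ^ 2 * ‖u‖ ^ 2 - 2 * ((b - a) * (a * ⟪u, t⟫)) + a ^ 2 * ‖t‖ ^ 2) / (b - a) := by
    rw [norm_add_sq_real]
    field_simp
    ring
  exact sub_nonneg.mp (key ▸ div_nonneg hsq hd.le)

/-- passivity inequality of the closed-loop system `T_τ(P) ×_F T̃_τ(Σ)`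
(Theorem 3 of the paper), with stacked input `r = (r₁, r₂)` and output `y = (y₁, ỹ₂)`
(inner products and Euclidean norms of the stacked vectors are written out
componentwise). -/
theorem stmt_8 {n₁ n₂ m : ℕ}
    (x₁ : ℕ → EuclideanSpace ℝ (Fin n₁)) (x₂ : ℕ → EuclideanSpace ℝ (Fin n₂))
    (u₁ y₁ ut₂ yt₂ r₁ r₂ : ℕ → EuclideanSpace ℝ (Fin m))
    (hint₁ : ∀ k, u₁ k = r₁ k - yt₂ k) (hint₂ : ∀ k, ut₂ k = r₂ k + y₁ k)
    (V₁ : EuclideanSpace ℝ (Fin n₁) → ℝ) (V₂ : EuclideanSpace ℝ (Fin n₂) → ℝ)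
    (δ₁ : EuclideanSpace ℝ (Fin n₁) → ℝ) (hδ₁ : ∀ z, 0 ≤ δ₁ z)
    (δ₂ : EuclideanSpace ℝ (Fin n₂) → ℝ) (hδ₂ : ∀ z, 0 ≤ δ₂ z)
    (δt₂ : ℝ) (hδt₂ : 0 ≤ δt₂)
    (ν₁' ρ₁' νt₂ ρt₂ : ℝ)
    (hdiss₁ : ∀ k₀ k₁ : ℕ, k₀ < k₁ →
      V₁ (x₁ k₁) - V₁ (x₁ k₀) ≤ δ₁ (x₁ k₀) +
        ∑ k ∈ Finset.Ico k₀ k₁, (⟪u₁ k, y₁ k⟫ - ν₁' * ‖u₁ k‖ ^ 2 - ρ₁' * ‖y₁ k‖ ^ 2))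
    (hdiss₂ : ∀ k₀ k₁ : ℕ, k₀ < k₁ →
      V₂ (x₂ k₁) - V₂ (x₂ k₀) ≤ δ₂ (x₂ k₀) +
        ∑ k ∈ Finset.Ico k₀ k₁,
          (⟪ut₂ k, yt₂ k⟫ - νt₂ * ‖ut₂ k‖ ^ 2 - ρt₂ * ‖yt₂ k‖ ^ 2 + δt₂))
    (νh ρh : ℝ) (hνh : νh < min ν₁' νt₂)
    (hρh : ρh ≤ min (ρ₁' - νh * νt₂ / (νt₂ - νh)) (ρt₂ - νh * ν₁' / (ν₁' - νh))) :
    ∀ k₀ k₁ : ℕ, k₀ < k₁ →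
      (V₁ (x₁ k₁) + V₂ (x₂ k₁)) - (V₁ (x₁ k₀) + V₂ (x₂ k₀)) ≤
        δ₁ (x₁ k₀) + δ₂ (x₂ k₀) +
          ∑ k ∈ Finset.Ico k₀ k₁,
            ((⟪r₁ k, y₁ k⟫ + ⟪r₂ k, yt₂ k⟫)
              - νh * (‖r₁ k‖ ^ 2 + ‖r₂ k‖ ^ 2)
              - ρh * (‖y₁ k‖ ^ 2 + ‖yt₂ k‖ ^ 2) + δt₂) := by
  intro k₀ k₁ hk
  have h₁ := hdiss₁ k₀ k₁ hk
  have h₂ := hdiss₂ k₀ k₁ hk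
  have hsum := Finset.sum_le_sum (s := Finset.Ico k₀ k₁)
    (f := fun k => (⟪u₁ k, y₁ k⟫ - ν₁' * ‖u₁ k‖ ^ 2 - ρ₁' * ‖y₁ k‖ ^ 2) +
      (⟪ut₂ k, yt₂ k⟫ - νt₂ * ‖ut₂ k‖ ^ 2 - ρt₂ * ‖yt₂ k‖ ^ 2 + δt₂))
    (g := fun k => (⟪r₁ k, y₁ k⟫ + ⟪r₂ k, yt₂ k⟫) - νh * (‖r₁ k‖ ^ 2 + ‖r₂ k‖ ^ 2)
      - ρh * (‖y₁ k‖ ^ 2 + ‖yt₂ k‖ ^ 2) + δt₂) fun k _ => by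
    obtain ⟨hν₁, hν₂⟩ := lt_min_iff.mp hνh
    obtain ⟨hρ₁, hρ₂⟩ := le_min_iff.mp hρh
    have hr₁ := mul_norm_add_sq_le hν₁ (u₁ k) (yt₂ k)
    have hr₂ := mul_norm_add_sq_le hν₂ (ut₂ k) (-y₁ k)
    rw [show u₁ k + yt₂ k = r₁ k by rw [hint₁]; abel] at hr₁
    rw [show ut₂ k + -y₁ k = r₂ k by rw [hint₂]; abel, norm_neg] at hr₂
    have hinner : ⟪u₁ k, y₁ k⟫ + ⟪ut₂ k, yt₂ k⟫ = ⟪r₁ k, y₁ k⟫ + ⟪r₂ k, yt₂ k⟫ := by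
      rw [hint₁, hint₂, inner_sub_left, inner_add_left, real_inner_comm (y₁ k) (yt₂ k)]
      ring
    have hy := mul_le_mul_of_nonneg_right hρ₁ (sq_nonneg ‖y₁ k‖)
    have hyt := mul_le_mul_of_nonneg_right hρ₂ (sq_nonneg ‖yt₂ k‖)
    linarith
  rw [Finset.sum_add_distrib] at hsum
  linarith
end

section
/- Let x : ℕ → ℝⁿ and u, y, ũ, ỹ : ℕ → ℝ^m be sequences, N ∈ ℕ, ϑ ≥ 0, μ₁, μ₂ > 0, m a positive integer, and p : ℝⁿ → ℝ. Suppose that for all k₀ ∈ ℕ: ∑_{k=k₀}^{k₀+N} (ϑ‖u[k]‖² + ‖y[k]‖²) ≥ p(x[k₀]), and for all k: ‖u[k] − ũ[k]‖ ≤ √m·μ₁ and ‖y[k] − ỹ[k]‖ ≤ √m·μ₂. Then for all k₀ ∈ ℕ: ∑_{k=k₀}^{k₀+N} (ϑ‖ũ[k]‖² + ‖ỹ[k]‖²) ≥ (1/2)·p(x[k₀]) − m(N+1)(ϑμ₁² + μ₂²). -/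
/-- Perturbing a vector by at most `√m * μ` preserves half of its squared norm up to `m * μ ^ 2`. -/
theorem half_norm_sq_sub_le_norm_sq {E : Type*} [SeminormedAddCommGroup E] {a b : E} {m : ℕ}
    {μ : ℝ} (h : ‖a - b‖ ≤ Real.sqrt m * μ) :
    (1 / 2) * ‖a‖ ^ 2 - m * μ ^ 2 ≤ ‖b‖ ^ 2 := by
  have herr : ‖a - b‖ ^ 2 ≤ m * μ ^ 2 := by
    calc ‖a - b‖ ^ 2 ≤ (Real.sqrt m * μ) ^ 2 := by gcongr
      _ = m * μ ^ 2 := by rw [mul_pow, Real.sq_sqrt m.cast_nonneg]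
  have htri : ‖a‖ ≤ ‖a - b‖ + ‖b‖ := by simpa using norm_add_le (a - b) b
  have hsq : ‖a‖ ^ 2 ≤ (‖a - b‖ + ‖b‖) ^ 2 := by gcongr
  nlinarith [sq_nonneg (‖a - b‖ - ‖b‖)]

/-- N-step strong detectability degrades gracefully under input/output
quantization: the quantized signals satisfy a halved detectability bound up to an explicit
additive constant. -/
theorem stmt_12 {n m : ℕ} (hm : 0 < m)
    (x : ℕ → EuclideanSpace ℝ (Fin n))
    (u y ut yt : ℕ → EuclideanSpace ℝ (Fin m))
    (N : ℕ) (ϑ : ℝ) (hϑ : 0 ≤ ϑ)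
    (μ₁ μ₂ : ℝ) (hμ₁ : 0 < μ₁) (hμ₂ : 0 < μ₂)
    (p : EuclideanSpace ℝ (Fin n) → ℝ)
    (hdet : ∀ k₀ : ℕ,
      p (x k₀) ≤ ∑ k ∈ Finset.Icc k₀ (k₀ + N), (ϑ * ‖u k‖ ^ 2 + ‖y k‖ ^ 2))
    (hqu : ∀ k, ‖u k - ut k‖ ≤ Real.sqrt m * μ₁)
    (hqy : ∀ k, ‖y k - yt k‖ ≤ Real.sqrt m * μ₂) :
    ∀ k₀ : ℕ,
      (1 / 2) * p (x k₀) - m * (N + 1) * (ϑ * μ₁ ^ 2 + μ₂ ^ 2) ≤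
        ∑ k ∈ Finset.Icc k₀ (k₀ + N), (ϑ * ‖ut k‖ ^ 2 + ‖yt k‖ ^ 2) := by
  intro k₀
  calc (1 / 2) * p (x k₀) - m * (N + 1) * (ϑ * μ₁ ^ 2 + μ₂ ^ 2)
      ≤ (1 / 2) * ∑ k ∈ Finset.Icc k₀ (k₀ + N), (ϑ * ‖u k‖ ^ 2 + ‖y k‖ ^ 2)
          - m * (N + 1) * (ϑ * μ₁ ^ 2 + μ₂ ^ 2) := by
        gcongr
        exact hdet k₀
    _ = ∑ k ∈ Finset.Icc k₀ (k₀ + N),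
          ((1 / 2) * (ϑ * ‖u k‖ ^ 2 + ‖y k‖ ^ 2) - m * (ϑ * μ₁ ^ 2 + μ₂ ^ 2)) := by
        have hcard : k₀ + N + 1 - k₀ = N + 1 := by omega
        rw [Finset.sum_sub_distrib, ← Finset.mul_sum, Finset.sum_const, Nat.card_Icc, hcard,
          nsmul_eq_mul]
        push_cast
        ring
    _ ≤ ∑ k ∈ Finset.Icc k₀ (k₀ + N), (ϑ * ‖ut k‖ ^ 2 + ‖yt k‖ ^ 2) := by
        refine Finset.sum_le_sum fun k _ => ?_
        have hu := mul_le_mul_of_nonneg_left (half_norm_sq_sub_le_norm_sq (hqu k)) hϑ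
        have hy := half_norm_sq_sub_le_norm_sq (hqy k)
        linarith
end

section
/- Let A be a real n×n matrix, B an n×m matrix, C an s×n matrix, γ > 0, and let P be a symmetric positive semidefinite n×n matrix. If the symmetric (n+m)×(n+m) block matrix M = [[AᵀP + PA + AᵀCᵀCA, PB + AᵀCᵀCB], [BᵀP + BᵀCᵀCA, −γ²I_m + BᵀCᵀCB]] is negative semidefinite, then for all x ∈ ℝⁿ and u ∈ ℝ^m: 2⟨Px, Ax + Bu⟩ + ‖C(Ax + Bu)‖² ≤ γ²‖u‖². Consequently, along any differentiable solution of ẋ(t) = Ax(t) + Bu(t), the function β(x) = xᵀPx satisfies (d/dt)β(x(t)) ≤ γ²‖u(t)‖² − ‖(d/dt)(Cx(t))‖². -/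
open Matrix

/-- The derivative of a dot product of two differentiable curves. -/
theorem HasDerivAt.dotProduct_curves {ι : Type*} [Fintype ι] {f g : ℝ → ι → ℝ} {f' g' : ι → ℝ}
    {t : ℝ} (hf : HasDerivAt f f' t) (hg : HasDerivAt g g' t) :
    HasDerivAt (fun s => f s ⬝ᵥ g s) (f' ⬝ᵥ g t + f t ⬝ᵥ g') t := by
  rw [hasDerivAt_pi] at hf hg
  simp only [dotProduct, ← Finset.sum_add_distrib]
  exact HasDerivAt.fun_sum fun i _ => (hf i).mul (hg i)

/-- The derivative of the quadratic form of a symmetric matrix along a differentiable curve. -/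
theorem Matrix.IsSymm.hasDerivAt_quadraticForm {ι : Type*} [Fintype ι]
    {P : Matrix ι ι ℝ} (hP : P.IsSymm) {x : ℝ → ι → ℝ} {v : ι → ℝ} {t : ℝ}
    (hx : HasDerivAt x v t) :
    HasDerivAt (fun s => x s ⬝ᵥ P *ᵥ x s) (2 * ((P *ᵥ x t) ⬝ᵥ v)) t := by
  have hPx : HasDerivAt (fun s => P *ᵥ x s) (P *ᵥ v) t :=
    P.mulVecLin.toContinuousLinearMap.hasFDerivAt.comp_hasDerivAt t hx
  convert hx.dotProduct_curves hPx using 1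
  rw [dotProduct_comm v, dotProduct_mulVec (x t), ← mulVec_transpose, hP.eq, two_mul]

/-- The quadratic form of the block matrix of the differential gain condition. -/
theorem dotProduct_fromBlocks_gain_mulVec {ι κ σ : Type*} [Fintype ι] [Fintype κ] [Fintype σ]
    [DecidableEq κ] (A : Matrix ι ι ℝ) (B : Matrix ι κ ℝ) (C : Matrix σ ι ℝ) (c : ℝ)
    {P : Matrix ι ι ℝ} (hP : P.IsSymm) (x : ι → ℝ) (u : κ → ℝ) :
    Sum.elim x u ⬝ᵥ Matrix.fromBlocks
      (Aᵀ * P + P * A + Aᵀ * Cᵀ * C * A) (P * B + Aᵀ * Cᵀ * C * B)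
      (Bᵀ * P + Bᵀ * Cᵀ * C * A) (-(c • (1 : Matrix κ κ ℝ)) + Bᵀ * Cᵀ * C * B) *ᵥ Sum.elim x u =
    2 * ((P *ᵥ x) ⬝ᵥ (A *ᵥ x + B *ᵥ u)) +
      (C *ᵥ (A *ᵥ x + B *ᵥ u)) ⬝ᵥ (C *ᵥ (A *ᵥ x + B *ᵥ u)) - c * (u ⬝ᵥ u) := by
  have hPx (w : ι → ℝ) : x ⬝ᵥ P *ᵥ w = (P *ᵥ x) ⬝ᵥ w := by
    rw [dotProduct_mulVec, ← mulVec_transpose, hP.eq]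
  simp only [fromBlocks_mulVec, Sum.elim_comp_inl, Sum.elim_comp_inr,
    sumElim_dotProduct_sumElim, add_mulVec, neg_mulVec, smul_mulVec, one_mulVec, mulVec_add,
    ← mulVec_mulVec, dotProduct_add, add_dotProduct, dotProduct_neg, dotProduct_smul, smul_eq_mul,
    hPx]
  simp only [dotProduct_mulVec _ Aᵀ, dotProduct_mulVec _ Bᵀ, dotProduct_mulVec _ Cᵀ,
    vecMul_transpose]
  rw [dotProduct_comm (A *ᵥ x) (P *ᵥ x), dotProduct_comm (B *ᵥ u) (P *ᵥ x)]
  ring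

/-- the LMI certificate (Remark 4 of the paper) for the differential gain
condition of an LTI system `ẋ = Ax + Bu` with output state-part `h₁(x) = Cx`. -/
theorem stmt_14 {n m sd : ℕ}
    (A : Matrix (Fin n) (Fin n) ℝ) (B : Matrix (Fin n) (Fin m) ℝ)
    (C : Matrix (Fin sd) (Fin n) ℝ)
    (γ : ℝ) (hγ : 0 < γ)
    (P : Matrix (Fin n) (Fin n) ℝ) (hP : P.PosSemidef)
    (M : Matrix (Fin n ⊕ Fin m) (Fin n ⊕ Fin m) ℝ)
    (hM : M = Matrix.fromBlocks
      (Aᵀ * P + P * A + Aᵀ * Cᵀ * C * A) (P * B + Aᵀ * Cᵀ * C * B)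
      (Bᵀ * P + Bᵀ * Cᵀ * C * A) (-(γ ^ 2 • (1 : Matrix (Fin m) (Fin m) ℝ)) + Bᵀ * Cᵀ * C * B))
    (hNSD : ∀ z : Fin n ⊕ Fin m → ℝ, z ⬝ᵥ M *ᵥ z ≤ 0) :
    (∀ (xv : Fin n → ℝ) (uv : Fin m → ℝ),
      2 * ((P *ᵥ xv) ⬝ᵥ (A *ᵥ xv + B *ᵥ uv)) +
          (C *ᵥ (A *ᵥ xv + B *ᵥ uv)) ⬝ᵥ (C *ᵥ (A *ᵥ xv + B *ᵥ uv)) ≤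
        γ ^ 2 * (uv ⬝ᵥ uv)) ∧
    (∀ (xf : ℝ → Fin n → ℝ) (uf : ℝ → Fin m → ℝ),
      (∀ t : ℝ, HasDerivAt xf (A *ᵥ xf t + B *ᵥ uf t) t) →
      ∀ t : ℝ,
        deriv (fun s => xf s ⬝ᵥ P *ᵥ xf s) t ≤
          γ ^ 2 * (uf t ⬝ᵥ uf t) -
            (C *ᵥ (A *ᵥ xf t + B *ᵥ uf t)) ⬝ᵥ (C *ᵥ (A *ᵥ xf t + B *ᵥ uf t))) := by
  have hS : P.IsSymm := by simpa using hP.isHermitian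
  have hgain (x : Fin n → ℝ) (u : Fin m → ℝ) :
      2 * ((P *ᵥ x) ⬝ᵥ (A *ᵥ x + B *ᵥ u)) +
          (C *ᵥ (A *ᵥ x + B *ᵥ u)) ⬝ᵥ (C *ᵥ (A *ᵥ x + B *ᵥ u)) ≤ γ ^ 2 * (u ⬝ᵥ u) := by
    have h := hNSD (Sum.elim x u)
    rw [hM, dotProduct_fromBlocks_gain_mulVec A B C (γ ^ 2) hS] at h
    linarith
  refine ⟨hgain, fun xf uf hx t => ?_⟩
  rw [(hS.hasDerivAt_quadraticForm (hx t)).deriv]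
  linarith [hgain (xf t) (uf t)]
end

section
/- Let A_d be a real n×n matrix, B_d an n×m matrix, C_d an s×n matrix, and D_d an s×m matrix. Let v ∈ ℕ and suppose the stacked observability matrix O = [C_d; C_dA_d; …; C_dA_d^v] (a (v+1)s × n matrix) has rank n. Then there exist ϑ > 0 and a symmetric positive definite n×n matrix M such that every trajectory of the discrete-time linear system x[k+1] = A_d x[k] + B_d u[k], y[k] = C_d x[k] + D_d u[k] satisfies, for every k₀ ∈ ℕ: ∑_{k=k₀}^{k₀+v} (ϑ‖u[k]‖² + ‖y[k]‖²) ≥ x[k₀]ᵀ M x[k₀]. In other words, an observable discrete-time linear system is v-step strongly detectable with ϑ and p(x) = xᵀMx. -/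
open Matrix

lemma dotProduct_self_add_le {ι : Type*} [Fintype ι] (a b : ι → ℝ) :
    (a + b) ⬝ᵥ (a + b) ≤ 2 * (a ⬝ᵥ a) + 2 * (b ⬝ᵥ b) := by
  simp only [dotProduct, Pi.add_apply, Finset.mul_sum, ← Finset.sum_add_distrib]
  exact Finset.sum_le_sum fun i _ => by nlinarith [sq_nonneg (a i - b i)]

lemma dotProduct_self_nonneg_real {ι : Type*} [Fintype ι] (a : ι → ℝ) : 0 ≤ a ⬝ᵥ a :=
  Finset.sum_nonneg fun i _ => mul_self_nonneg (a i)

lemma exists_mulVec_dotProduct_self_le {ι κ : Type*} [Fintype ι] [Fintype κ]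
    (A : Matrix ι κ ℝ) :
    ∃ c : ℝ, 0 ≤ c ∧ ∀ w : κ → ℝ, A *ᵥ w ⬝ᵥ A *ᵥ w ≤ c * (w ⬝ᵥ w) := by
  refine ⟨∑ i, ∑ j, A i j ^ 2, by positivity, fun w => ?_⟩
  simp only [dotProduct, mulVec, ← pow_two]
  rw [Finset.sum_mul]
  exact Finset.sum_le_sum fun i _ => Finset.sum_mul_sq_le_sq_mul_sq _ _ _

/-- The forced response after `i` steps is bounded by the energy of the input so far. -/
lemma exists_forced_response_le {n m : ℕ} (A : Matrix (Fin n) (Fin n) ℝ)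
    (B : Matrix (Fin n) (Fin m) ℝ) (i : ℕ) :
    ∃ c : ℝ, 0 ≤ c ∧ ∀ (x : ℕ → Fin n → ℝ) (u : ℕ → Fin m → ℝ),
      (∀ k, x (k + 1) = A *ᵥ x k + B *ᵥ u k) → ∀ k₀ : ℕ,
        (x (k₀ + i) - (A ^ i) *ᵥ x k₀) ⬝ᵥ (x (k₀ + i) - (A ^ i) *ᵥ x k₀) ≤
          c * ∑ j ∈ Finset.range i, u (k₀ + j) ⬝ᵥ u (k₀ + j) := by
  induction i with
  | zero => exact ⟨0, le_rfl, by simp⟩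
  | succ i ih =>
    obtain ⟨c, hc, h⟩ := ih
    obtain ⟨a, ha, hA⟩ := exists_mulVec_dotProduct_self_le A
    obtain ⟨b, hb, hB⟩ := exists_mulVec_dotProduct_self_le B
    refine ⟨2 * (a * c) + 2 * b, by positivity, fun x u hx k₀ => ?_⟩
    have key : x (k₀ + (i + 1)) - (A ^ (i + 1)) *ᵥ x k₀ =
        A *ᵥ (x (k₀ + i) - (A ^ i) *ᵥ x k₀) + B *ᵥ u (k₀ + i) := by
      rw [← add_assoc, hx, mulVec_sub, mulVec_mulVec, ← pow_succ']
      abel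
    rw [key, Finset.sum_range_succ]
    have hS : 0 ≤ ∑ j ∈ Finset.range i, u (k₀ + j) ⬝ᵥ u (k₀ + j) :=
      Finset.sum_nonneg fun j _ => dotProduct_self_nonneg_real _
    have hu := dotProduct_self_nonneg_real (u (k₀ + i))
    have h₁ := mul_le_mul_of_nonneg_left (h x u hx k₀) ha
    have h₂ := dotProduct_self_add_le (A *ᵥ (x (k₀ + i) - (A ^ i) *ᵥ x k₀)) (B *ᵥ u (k₀ + i))
    have h₃ := hA (x (k₀ + i) - (A ^ i) *ᵥ x k₀)
    have h₄ := hB (u (k₀ + i))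
    have h₅ := mul_nonneg (mul_nonneg ha hc) hu
    have h₆ := mul_nonneg hb hS
    linarith

/-- The free output after `i` steps is bounded by the actual output and the input energy. -/
lemma exists_free_output_le {n m s : ℕ} (A : Matrix (Fin n) (Fin n) ℝ)
    (B : Matrix (Fin n) (Fin m) ℝ) (C : Matrix (Fin s) (Fin n) ℝ)
    (D : Matrix (Fin s) (Fin m) ℝ) (i : ℕ) :
    ∃ c : ℝ, 0 ≤ c ∧ ∀ (x : ℕ → Fin n → ℝ) (u : ℕ → Fin m → ℝ) (y : ℕ → Fin s → ℝ),
      (∀ k, x (k + 1) = A *ᵥ x k + B *ᵥ u k) → (∀ k, y k = C *ᵥ x k + D *ᵥ u k) →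
      ∀ k₀ : ℕ, (1 / 2 : ℝ) * ((C * A ^ i) *ᵥ x k₀ ⬝ᵥ (C * A ^ i) *ᵥ x k₀) ≤
        y (k₀ + i) ⬝ᵥ y (k₀ + i) +
          c * ∑ j ∈ Finset.range (i + 1), u (k₀ + j) ⬝ᵥ u (k₀ + j) := by
  obtain ⟨c, hc, h⟩ := exists_forced_response_le A B i
  obtain ⟨b, hb, hD⟩ := exists_mulVec_dotProduct_self_le (-D)
  obtain ⟨a, ha, hC⟩ := exists_mulVec_dotProduct_self_le (-C)
  refine ⟨2 * (a * c) + 2 * b, by positivity, fun x u y hx hy k₀ => ?_⟩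
  set e := x (k₀ + i) - (A ^ i) *ᵥ x k₀ with he
  have key : (C * A ^ i) *ᵥ x k₀ = y (k₀ + i) + ((-C) *ᵥ e + (-D) *ᵥ u (k₀ + i)) := by
    rw [hy, he, mulVec_sub, neg_mulVec, neg_mulVec, neg_mulVec, mulVec_mulVec]
    abel
  rw [key, Finset.sum_range_succ]
  have hS : 0 ≤ ∑ j ∈ Finset.range i, u (k₀ + j) ⬝ᵥ u (k₀ + j) :=
    Finset.sum_nonneg fun j _ => dotProduct_self_nonneg_real _
  have hu := dotProduct_self_nonneg_real (u (k₀ + i))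
  have h₁ := mul_le_mul_of_nonneg_left (h x u hx k₀) ha
  have h₂ := dotProduct_self_add_le ((-C) *ᵥ e) ((-D) *ᵥ u (k₀ + i))
  have h₃ := dotProduct_self_add_le (y (k₀ + i)) ((-C) *ᵥ e + (-D) *ᵥ u (k₀ + i))
  have h₄ := hC e
  have h₅ := hD (u (k₀ + i))
  have h₆ := mul_nonneg (mul_nonneg ha hc) hu
  have h₇ := mul_nonneg hb hS
  linarith

lemma mulVec_injective_of_rank_eq {ι : Type*} [Fintype ι] {n : ℕ}
    (O : Matrix ι (Fin n) ℝ) (h : O.rank = n) : Function.Injective O.mulVec := by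
  have hker := O.mulVecLin.finrank_range_add_finrank_ker
  rw [← Matrix.rank, h, Module.finrank_fin_fun, Nat.add_eq_left, Submodule.finrank_eq_zero,
    LinearMap.ker_eq_bot] at hker
  exact hker

/-- an observable discrete-time linear system is v-step strongly detectable
with a quadratic detectability function `p(x) = xᵀ M x` for some positive definite
(symmetric) matrix `M` and some `ϑ > 0`. -/
theorem stmt_15 {n m sd : ℕ} (v : ℕ)
    (A : Matrix (Fin n) (Fin n) ℝ) (B : Matrix (Fin n) (Fin m) ℝ)
    (C : Matrix (Fin sd) (Fin n) ℝ) (D : Matrix (Fin sd) (Fin m) ℝ)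
    (O : Matrix (Fin (v + 1) × Fin sd) (Fin n) ℝ)
    (hO : ∀ (i : Fin (v + 1)) (j : Fin sd) (r : Fin n), O (i, j) r = (C * A ^ (i : ℕ)) j r)
    (hrank : O.rank = n) :
    ∃ (ϑ : ℝ) (M : Matrix (Fin n) (Fin n) ℝ), 0 < ϑ ∧ M.PosDef ∧
      ∀ (x : ℕ → Fin n → ℝ) (u : ℕ → Fin m → ℝ) (y : ℕ → Fin sd → ℝ),
        (∀ k, x (k + 1) = A *ᵥ x k + B *ᵥ u k) →
        (∀ k, y k = C *ᵥ x k + D *ᵥ u k) →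
        ∀ k₀ : ℕ,
          x k₀ ⬝ᵥ M *ᵥ x k₀ ≤
            ∑ k ∈ Finset.Icc k₀ (k₀ + v), (ϑ * (u k ⬝ᵥ u k) + y k ⬝ᵥ y k) := by
  choose c hc h using exists_free_output_le A B C D
  refine ⟨∑ i ∈ Finset.range (v + 1), c i + 1, (1 / 2 : ℝ) • (Oᴴ * O), ?_, ?_, ?_⟩
  · have := Finset.sum_nonneg fun i (_ : i ∈ Finset.range (v + 1)) => hc i
    linarith
  · exact (PosDef.conjTranspose_mul_self O (mulVec_injective_of_rank_eq O hrank)).smul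
      (by norm_num)
  · intro x u y hx hy k₀
    have hquad : x k₀ ⬝ᵥ ((1 / 2 : ℝ) • (Oᴴ * O)) *ᵥ x k₀ = ∑ i ∈ Finset.range (v + 1),
        (1 / 2 : ℝ) * ((C * A ^ i) *ᵥ x k₀ ⬝ᵥ (C * A ^ i) *ᵥ x k₀) := by
      have hOx : ∀ p : Fin (v + 1) × Fin sd,
          (O *ᵥ x k₀) p = ((C * A ^ (p.1 : ℕ)) *ᵥ x k₀) p.2 := fun p => by
        simp only [mulVec, dotProduct, ← hO]
      rw [smul_mulVec, dotProduct_smul, ← mulVec_mulVec, dotProduct_mulVec,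
        conjTranspose_eq_transpose_of_trivial, vecMul_transpose, ← Finset.mul_sum,
        Finset.sum_range, smul_eq_mul]
      simp only [dotProduct, hOx, Fintype.sum_prod_type]
    have hIcc : ∀ f : ℕ → ℝ, ∑ k ∈ Finset.Icc k₀ (k₀ + v), f k =
        ∑ i ∈ Finset.range (v + 1), f (k₀ + i) := fun f => by
      rw [← Finset.Ico_add_one_right_eq_Icc, Finset.sum_Ico_eq_sum_range]
      congr 2
      omega
    rw [hIcc, Finset.sum_add_distrib, ← Finset.mul_sum, hquad]
    set S := ∑ j ∈ Finset.range (v + 1), u (k₀ + j) ⬝ᵥ u (k₀ + j)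
    have hS0 : 0 ≤ S := Finset.sum_nonneg fun j _ => dotProduct_self_nonneg_real _
    have hsum : ∑ i ∈ Finset.range (v + 1),
        (1 / 2 : ℝ) * ((C * A ^ i) *ᵥ x k₀ ⬝ᵥ (C * A ^ i) *ᵥ x k₀) ≤
        ∑ i ∈ Finset.range (v + 1), (y (k₀ + i) ⬝ᵥ y (k₀ + i) + c i * S) := by
      refine Finset.sum_le_sum fun i hi => (h i x u y hx hy k₀).trans ?_
      gcongr
      · exact hc i
      · exact Finset.sum_le_sum_of_subset_of_nonneg
          (Finset.range_mono (by have := Finset.mem_range.mp hi; omega))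
          fun j _ _ => dotProduct_self_nonneg_real _
    rw [Finset.sum_add_distrib, ← Finset.sum_mul] at hsum
    linarith
end

section
/- Let τ > 0, γ > 0, β ≥ 0, and k₀ < k₁ in ℕ. Let (u_k) be a sequence in ℝ^m and define the piecewise-constant input u : ℝ → ℝ^m by u(t) = u_k for t ∈ [kτ, (k+1)τ). Let g : ℝ → ℝ^m be continuously differentiable with ∫_{k₀τ}^{k₁τ} ‖g′(t)‖² dt ≤ γ² ∫_{k₀τ}^{k₁τ} ‖u(t)‖² dt + β, let h₂ : ℝ^m → ℝ^m, and set y(t) = g(t) + h₂(u(t)) and y_k = g(kτ) + h₂(u_k). Then ∫_{k₀τ}^{k₁τ} ⟨u(t), y(t)⟩ dt ≤ τ·∑_{k=k₀}^{k₁−1} ⟨u_k, y_k⟩ + τ²γ·∑_{k=k₀}^{k₁−1} ‖u_k‖² + τβ/γ. -/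
open scoped RealInnerProductSpace

/-- The integral of a function that agrees with a continuous function `F k` on the interior of
each sampling interval splits as a sum over the sampling intervals. -/
theorem integral_eq_sum_of_eqOn_sampling_intervals {τ : ℝ} (hτ : 0 ≤ τ) {k₀ k₁ : ℕ} (hk : k₀ ≤ k₁)
    {f : ℝ → ℝ} {F : ℕ → ℝ → ℝ} (hF : ∀ k, Continuous (F k))
    (hf : ∀ k : ℕ, Set.EqOn f (F k) (Set.Ioo ((k : ℝ) * τ) (((k : ℝ) + 1) * τ))) :
    ∫ t in ((k₀ : ℝ) * τ)..((k₁ : ℝ) * τ), f t =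
      ∑ k ∈ Finset.Ico k₀ k₁, ∫ t in ((k : ℝ) * τ)..(((k : ℝ) + 1) * τ), F k t := by
  have hle (k : ℕ) : (k : ℝ) * τ ≤ ((k : ℝ) + 1) * τ := by nlinarith
  have hpiece (k : ℕ) :
      IntervalIntegrable f MeasureTheory.volume ((k : ℝ) * τ) (((k : ℝ) + 1) * τ) := by
    refine ((hF k).intervalIntegrable _ _).congr_uIoo ?_
    rw [Set.uIoo_of_le (hle k)]
    exact (hf k).symm
  have hsum := intervalIntegral.sum_integral_adjacent_intervals_Ico
    (a := fun k : ℕ => (k : ℝ) * τ) hk (fun k _ => by simpa using hpiece k)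
  rw [← hsum]
  refine Finset.sum_congr rfl fun k _ => ?_
  simpa using intervalIntegral.integral_congr_Ioo_of_le (hle k) (hf k)

/-- On one sampling interval, the supply with output sampled at the left endpoint approximates
the continuous-time supply up to the energies of the input and of the derivative. -/
theorem integral_inner_add_le_of_hasDerivAt {E : Type*} [NormedAddCommGroup E]
    [InnerProductSpace ℝ E] {g g' : ℝ → E} (hg : ∀ t, HasDerivAt g (g' t) t)
    (hg' : Continuous g') {γ : ℝ} (hγ : 0 < γ) {a b : ℝ} (hab : a ≤ b) (v w : E) :
    ∫ t in a..b, ⟪v, g t + w⟫ ≤ (b - a) * ⟪v, g a + w⟫ +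
      (b - a) * (γ / 2 * ((b - a) * ‖v‖ ^ 2) + 1 / (2 * γ) * ∫ t in a..b, ‖g' t‖ ^ 2) := by
  have hgc : Continuous g := continuous_iff_continuousAt.2 fun t => (hg t).continuousAt
  have hsupply : Continuous fun t => γ / 2 * ‖v‖ ^ 2 + 1 / (2 * γ) * ‖g' t‖ ^ 2 := by fun_prop
  have hyoung (s : ℝ) : ⟪v, g' s⟫ ≤ γ / 2 * ‖v‖ ^ 2 + 1 / (2 * γ) * ‖g' s‖ ^ 2 := by
    refine (real_inner_le_norm _ _).trans ?_
    rw [← sub_nonneg]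
    have : γ / 2 * ‖v‖ ^ 2 + 1 / (2 * γ) * ‖g' s‖ ^ 2 - ‖v‖ * ‖g' s‖ =
        (γ * ‖v‖ - ‖g' s‖) ^ 2 / (2 * γ) := by
      field_simp
      ring
    rw [this]
    positivity
  have henergy : ∫ s in a..b, (γ / 2 * ‖v‖ ^ 2 + 1 / (2 * γ) * ‖g' s‖ ^ 2) =
      γ / 2 * ((b - a) * ‖v‖ ^ 2) + 1 / (2 * γ) * ∫ t in a..b, ‖g' t‖ ^ 2 := by
    rw [intervalIntegral.integral_add (by simp)
      (Continuous.intervalIntegrable (by fun_prop) _ _),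
      intervalIntegral.integral_const_mul (1 / (2 * γ)),
      intervalIntegral.integral_const, smul_eq_mul]
    ring
  have hbound (t : ℝ) (ht : t ∈ Set.Icc a b) : ⟪v, g t + w⟫ ≤ ⟪v, g a + w⟫ +
      (γ / 2 * ((b - a) * ‖v‖ ^ 2) + 1 / (2 * γ) * ∫ t in a..b, ‖g' t‖ ^ 2) := by
    have hftc : ∫ s in a..t, ⟪v, g' s⟫ = ⟪v, g t⟫ - ⟪v, g a⟫ :=
      intervalIntegral.integral_eq_sub_of_hasDerivAt
        (fun s _ => by simpa using (hasDerivAt_const s v).inner ℝ (hg s))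
        (Continuous.intervalIntegrable (by fun_prop) _ _)
    have hmono : ∫ s in a..t, ⟪v, g' s⟫ ≤
        ∫ s in a..t, (γ / 2 * ‖v‖ ^ 2 + 1 / (2 * γ) * ‖g' s‖ ^ 2) :=
      intervalIntegral.integral_mono_on ht.1
        (Continuous.intervalIntegrable (by fun_prop) _ _) (hsupply.intervalIntegrable _ _)
        fun s _ => hyoung s
    have hext : ∫ s in a..t, (γ / 2 * ‖v‖ ^ 2 + 1 / (2 * γ) * ‖g' s‖ ^ 2) ≤
        ∫ s in a..b, (γ / 2 * ‖v‖ ^ 2 + 1 / (2 * γ) * ‖g' s‖ ^ 2) :=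
      intervalIntegral.integral_mono_interval le_rfl ht.1 ht.2
        (Filter.Eventually.of_forall fun s => by
          simp only [Pi.zero_apply]
          positivity) (hsupply.intervalIntegrable _ _)
    rw [inner_add_right, inner_add_right]
    linarith
  have hpiece := intervalIntegral.integral_mono_on (μ := MeasureTheory.volume) hab
    (Continuous.intervalIntegrable (by fun_prop) _ _) intervalIntegrable_const hbound
  rw [intervalIntegral.integral_const, smul_eq_mul, mul_add] at hpiece
  exact hpiece

/-- the key integral–sum comparison estimate in the proof of the sampling
passivity-degradation theorem: the continuous-time supply `∫ ⟨u, y⟩` over `[k₀τ, k₁τ]` is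
bounded by the discrete-time supply of the zero-order-hold sampled system plus
`τ²γ ∑ ‖u_k‖² + τβ/γ`, where `y(t) = g(t) + h₂(u(t))` and `y_k = g(kτ) + h₂(u_k)`. -/
theorem stmt_19 {m : ℕ}
    (τ γ β : ℝ) (hτ : 0 < τ) (hγ : 0 < γ) (hβ : 0 ≤ β)
    (k₀ k₁ : ℕ) (hk : k₀ < k₁)
    (useq : ℕ → EuclideanSpace ℝ (Fin m)) (u : ℝ → EuclideanSpace ℝ (Fin m))
    (hu : ∀ k : ℕ, ∀ t ∈ Set.Ico ((k : ℝ) * τ) (((k : ℝ) + 1) * τ), u t = useq k)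
    (g g' : ℝ → EuclideanSpace ℝ (Fin m))
    (hg : ∀ t : ℝ, HasDerivAt g (g' t) t) (hg'c : Continuous g')
    (hgain : (∫ t in ((k₀ : ℝ) * τ)..((k₁ : ℝ) * τ), ‖g' t‖ ^ 2) ≤
      γ ^ 2 * (∫ t in ((k₀ : ℝ) * τ)..((k₁ : ℝ) * τ), ‖u t‖ ^ 2) + β)
    (h₂ : EuclideanSpace ℝ (Fin m) → EuclideanSpace ℝ (Fin m)) :
    (∫ t in ((k₀ : ℝ) * τ)..((k₁ : ℝ) * τ), ⟪u t, g t + h₂ (u t)⟫) ≤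
      τ * ∑ k ∈ Finset.Ico k₀ k₁, ⟪useq k, g ((k : ℝ) * τ) + h₂ (useq k)⟫
        + τ ^ 2 * γ * ∑ k ∈ Finset.Ico k₀ k₁, ‖useq k‖ ^ 2 + τ * β / γ := by
  have hu' (k : ℕ) (t : ℝ) (ht : t ∈ Set.Ioo ((k : ℝ) * τ) (((k : ℝ) + 1) * τ)) : u t = useq k :=
    hu k t (Set.Ioo_subset_Ico_self ht)
  have hgc : Continuous g := continuous_iff_continuousAt.2 fun t => (hg t).continuousAt
  have hlen (k : ℕ) : ((k : ℝ) + 1) * τ - (k : ℝ) * τ = τ := by ring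
  have hinput : ∫ t in ((k₀ : ℝ) * τ)..((k₁ : ℝ) * τ), ‖u t‖ ^ 2 =
      τ * ∑ k ∈ Finset.Ico k₀ k₁, ‖useq k‖ ^ 2 := by
    rw [integral_eq_sum_of_eqOn_sampling_intervals hτ.le hk.le
      (F := fun k _ => ‖useq k‖ ^ 2) (fun _ => continuous_const)
      (fun k t ht => by simp only [hu' k t ht]), Finset.mul_sum]
    simp only [intervalIntegral.integral_const, hlen, smul_eq_mul]
  have hderiv := integral_eq_sum_of_eqOn_sampling_intervals hτ.le hk.le
    (f := fun t => ‖g' t‖ ^ 2) (F := fun _ t => ‖g' t‖ ^ 2) (fun _ => by fun_prop)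
    (fun k => Set.eqOn_refl _ _)
  rw [hinput, hderiv] at hgain
  rw [integral_eq_sum_of_eqOn_sampling_intervals hτ.le hk.le
    (F := fun k t => ⟪useq k, g t + h₂ (useq k)⟫) (fun _ => by fun_prop)
    (fun k t ht => by simp only [hu' k t ht])]
  have hstep := Finset.sum_le_sum fun k (_ : k ∈ Finset.Ico k₀ k₁) =>
    integral_inner_add_le_of_hasDerivAt hg hg'c hγ
      (show (k : ℝ) * τ ≤ ((k : ℝ) + 1) * τ by nlinarith) (useq k) (h₂ (useq k))
  simp only [hlen, Finset.sum_add_distrib, ← Finset.mul_sum] at hstep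
  refine hstep.trans ?_
  have hscaled := mul_le_mul_of_nonneg_left hgain (show 0 ≤ τ / (2 * γ) by positivity)
  have hexpand (S : ℝ) : τ / (2 * γ) * (γ ^ 2 * (τ * S) + β) =
      τ ^ 2 * γ / 2 * S + τ * β / γ / 2 := by
    field_simp
  have hβ' : 0 ≤ τ * β / γ := by positivity
  rw [hexpand] at hscaled
  have hcoef : τ / (2 * γ) = τ * (1 / (2 * γ)) := by ring
  rw [hcoef] at hscaled
  linarith
end
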